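/- Assume the standing hypotheses on system (S) and suppose there exists ω ∈ ℝ² with L(ω) = 0 such that the Jacobian matrix JL(ω) is a D⁺-matrix. Then there exists a Lebesgue-measurable set E ⊆ ℝ⁴ of infinite Lebesgue measure such that every C² solution x = (x₁,x₂) : [0,∞) → ℝ² of (S) with (x₁(0), x₂(0), ẋ₁(0), ẋ₂(0)) ∈ E satisfies lim_{t→+∞} (x_i(t)² + ẋ_i(t)²) = +∞ for i = 1,2. -/

import Mathlib

open Real MeasureTheory Filter

noncomputable section

/-- `C` is the asymmetric cosine of the pair `(a, b)` for the resonance integer `n`: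
the even, `2π/n`-periodic function equal to `cos(√a t)` on `[0, π/(2√a)]` and to
`−√(a/b)·sin(√b(t − π/(2√a)))` on `[π/(2√a), π/n]`. -/
def IsAsymCos (n : ℕ) (a b : ℝ) (C : ℝ → ℝ) : Prop :=
  (∀ t, C (-t) = C t) ∧ (∀ t, C (t + 2 * π / n) = C t) ∧
  (∀ t ∈ Set.Icc (0 : ℝ) (π / (2 * Real.sqrt a)), C t = Real.cos (Real.sqrt a * t)) ∧
  (∀ t ∈ Set.Icc (π / (2 * Real.sqrt a)) (π / n),
      C t = - Real.sqrt (a / b) * Real.sin (Real.sqrt b * (t - π / (2 * Real.sqrt a))))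

/-- gluing of two smooth pieces of a periodic function -/
lemma glue (g G0 G1 D0 D1 : ℝ → ℝ) (T τ : ℝ) (hτ : 0 < τ) (hT : τ < T - τ)
    (hper : ∀ t, g (t + T) = g t)
    (h0 : ∀ t, HasDerivAt G0 (D0 t) t) (h1 : ∀ t, HasDerivAt G1 (D1 t) t)
    (e0 : D0 τ = D1 τ) (e1 : D0 (-τ) = D1 (T - τ))
    (g0 : ∀ t ∈ Set.Icc (-τ) τ, g t = G0 t) (g1 : ∀ t ∈ Set.Icc τ (T - τ), g t = G1 t) :
    (∀ t ∈ Set.Icc (-τ) τ, HasDerivAt g (D0 t) t) ∧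
    (∀ t ∈ Set.Icc τ (T - τ), HasDerivAt g (D1 t) t) := by
  have w0 : ∀ t ∈ Set.Icc (-τ) τ, HasDerivWithinAt g (D0 t) (Set.Icc (-τ) τ) t := fun t ht =>
    (h0 t).hasDerivWithinAt.congr g0 (g0 t ht)
  have w1 : ∀ t ∈ Set.Icc τ (T - τ), HasDerivWithinAt g (D1 t) (Set.Icc τ (T - τ)) t := fun t ht =>
    (h1 t).hasDerivWithinAt.congr g1 (g1 t ht)
  have wm : HasDerivWithinAt g (D1 (T - τ)) (Set.Icc (τ - T) (-τ)) (-τ) := by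
    have hd : HasDerivAt (fun t => G1 (t + T)) (D1 (T - τ)) (-τ) := by
      have := h1 (-τ + T)
      have h2 := HasDerivAt.comp_add_const (-τ) T this
      rwa [show -τ + T = T - τ by ring] at h2
    have hh : ∀ t ∈ Set.Icc (τ - T) (-τ), g t = G1 (t + T) := by
      intro t ht
      rw [← hper t]
      exact g1 _ ⟨by linarith [ht.1], by linarith [ht.2]⟩
    exact hd.hasDerivWithinAt.congr hh (hh _ ⟨by linarith, le_refl _⟩)
  have am : HasDerivAt g (D0 (-τ)) (-τ) := by
    have h2 : HasDerivWithinAt g (D0 (-τ)) (Set.Icc (τ - T) (-τ) ∪ Set.Icc (-τ) τ) (-τ) := by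
      refine HasDerivWithinAt.union ?_ (w0 _ ⟨le_refl _, by linarith⟩)
      rw [e1]; exact wm
    rw [Set.Icc_union_Icc_eq_Icc (by linarith) (by linarith)] at h2
    exact h2.hasDerivAt (Icc_mem_nhds (by linarith) (by linarith))
  have ap : HasDerivAt g (D0 τ) τ := by
    have h2 : HasDerivWithinAt g (D0 τ) (Set.Icc (-τ) τ ∪ Set.Icc τ (T - τ)) τ := by
      refine HasDerivWithinAt.union (w0 _ ⟨by linarith, le_refl _⟩) ?_
      rw [e0]; exact w1 _ ⟨le_refl _, hT.le⟩
    rw [Set.Icc_union_Icc_eq_Icc (by linarith) (by linarith)] at h2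
    exact h2.hasDerivAt (Icc_mem_nhds (by linarith) (by linarith))
  have ae : HasDerivAt g (D1 (T - τ)) (T - τ) := by
    have h2 : HasDerivAt (fun t => g (t - T)) (D0 (-τ)) (T - τ) := by
      apply HasDerivAt.comp_sub_const
      rwa [show T - τ - T = -τ by ring]
    rw [← e1]
    convert h2 using 1
    funext t
    rw [← hper (t - T)]; congr 1; ring
  constructor
  · intro t ht
    rcases eq_or_lt_of_le ht.1 with h | h
    · rw [← h]; exact am
    rcases eq_or_lt_of_le ht.2 with h' | h'
    · rw [h']; exact ap
    exact (w0 t ht).hasDerivAt (Icc_mem_nhds h h')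
  · intro t ht
    rcases eq_or_lt_of_le ht.1 with h | h
    · rw [← h, ← e0]; exact ap
    rcases eq_or_lt_of_le ht.2 with h' | h'
    · rw [h']; exact ae
    exact (w1 t ht).hasDerivAt (Icc_mem_nhds h h')

structure Osc (n : ℕ) (a b τ : ℝ) (C S : ℝ → ℝ) : Prop where
  apos : 0 < a
  bpos : 0 < b
  npos : (0 : ℝ) < n
  τpos : 0 < τ
  τlt : τ < 2 * π / n - τ
  hC : ∀ t, HasDerivAt C (S t) t
  hS : ∀ t, HasDerivAt S (-(a * max (C t) 0 - b * max (-C t) 0)) t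
  hE : ∀ t, S t ^ 2 + a * max (C t) 0 ^ 2 + b * max (-C t) 0 ^ 2 = a
  hper : ∀ t, C (t + 2 * π / n) = C t
  pos : ∀ t ∈ Set.Ioo (-τ) τ, 0 < C t
  neg : ∀ t ∈ Set.Ioo τ (2 * π / n - τ), C t < 0
  int0 : ∫ s in (-τ)..τ, C s = 2 / Real.sqrt a
  int1 : ∫ s in τ..(2 * π / n - τ), C s = -2 * Real.sqrt a / b

lemma exists_osc (n : ℕ) (hn : 1 ≤ n) (a b : ℝ) (ha : (n : ℝ) ^ 2 / 4 < a) (hb : 0 < b)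
    (hres : 1 / Real.sqrt a + 1 / Real.sqrt b = 2 / (n : ℝ))
    (C : ℝ → ℝ) (h : IsAsymCos n a b C) :
    ∃ S, Osc n a b (π / (2 * Real.sqrt a)) C S := by
  obtain ⟨hev, hper, hc, hs⟩ := h
  have hn0 : (0 : ℝ) < n := by exact_mod_cast hn
  have ha0 : 0 < a := lt_trans (by positivity) ha
  have sab : Real.sqrt (a / b) = Real.sqrt a / Real.sqrt b := Real.sqrt_div ha0.le b
  rw [sab] at hs
  have sapos := Real.sqrt_pos.2 ha0
  have sbpos := Real.sqrt_pos.2 hb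
  have sasq := Real.sq_sqrt ha0.le
  have sbsq := Real.sq_sqrt hb.le
  set sa := Real.sqrt a
  set sb := Real.sqrt b
  set τ := π / (2 * sa) with hτ
  set σ := π / (2 * sb) with hσ
  have hτpos : 0 < τ := by positivity
  have hσpos : 0 < σ := by positivity
  have hpn : π / n = τ + σ := by
    have : π / n = π / 2 * (2 / n) := by field_simp
    rw [this, ← hres, hτ, hσ]; field_simp
  have hT : 2 * π / n = 2 * (τ + σ) := by rw [← hpn]; ring
  have saτ : sa * τ = π / 2 := by rw [hτ]; field_simp
  have sbσ : sb * σ = π / 2 := by rw [hσ]; field_simp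
  set T := 2 * π / n with hTdef
  have g0 : ∀ t ∈ Set.Icc (-τ) τ, C t = Real.cos (sa * t) := by
    intro t ht
    rcases le_total 0 t with h | h
    · exact hc t ⟨h, ht.2⟩
    · rw [← hev t, hc (-t) ⟨by linarith, by linarith [ht.1]⟩, mul_neg, Real.cos_neg]
  have g1 : ∀ t ∈ Set.Icc τ (T - τ), C t = -(sa / sb) * Real.sin (sb * (t - τ)) := by
    intro t ht
    rcases le_total t (π / n) with h | h
    · exact hs t ⟨ht.1, h⟩
    · rw [← hev t, ← hper (-t), hs (-t + T) ⟨by linarith [ht.2], by rw [hT]; linarith⟩]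
      rw [show sb * (-t + T - τ) = π - sb * (t - τ) by rw [hT]; linear_combination 2 * sbσ,
        Real.sin_pi_sub]
  have hτT : τ < T - τ := by rw [hT]; linarith
  have sbT : sb * (T - τ - τ) = π := by rw [hT]; linear_combination 2 * sbσ
  have G := glue C (fun t => Real.cos (sa * t)) (fun t => -(sa / sb) * Real.sin (sb * (t - τ)))
    (fun t => -sa * Real.sin (sa * t)) (fun t => -sa * Real.cos (sb * (t - τ))) T τ hτpos hτT hper
    (fun t => by
      have := ((hasDerivAt_id' t).const_mul sa).cos
      exact this.congr_deriv (by ring))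
    (fun t => by
      have := (((((hasDerivAt_id' t).sub_const τ).const_mul sb)).sin).const_mul (-(sa / sb))
      exact this.congr_deriv (by field_simp))
    (by simp [saτ]) (by simp [saτ, sbT]) g0 g1
  have hSper : ∀ t, deriv C (t + T) = deriv C t := by
    intro t
    rw [← deriv_comp_add_const]
    congr 1
    funext u; exact hper u
  have H := glue (deriv C) (fun t => -sa * Real.sin (sa * t)) (fun t => -sa * Real.cos (sb * (t - τ)))
    (fun t => -a * Real.cos (sa * t)) (fun t => sa * sb * Real.sin (sb * (t - τ))) T τ hτpos hτT hSper
    (fun t => by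
      have := (((hasDerivAt_id' t).const_mul sa).sin).const_mul (-sa)
      exact this.congr_deriv (by rw [← sasq]; ring))
    (fun t => by
      have := (((((hasDerivAt_id' t).sub_const τ).const_mul sb)).cos).const_mul (-sa)
      exact this.congr_deriv (by ring))
    (by simp [saτ]) (by simp [saτ, sbT]) (fun t ht => (G.1 t ht).deriv) (fun t ht => (G.2 t ht).deriv)
  have hCp : Function.Periodic C T := hper
  have hSp : Function.Periodic (deriv C) T := hSper
  have hTpos : 0 < T := by positivity
  have cover : ∀ t : ℝ, ∃ k : ℤ, t - k • T ∈ Set.Icc (-τ) τ ∨ t - k • T ∈ Set.Icc τ (T - τ) := by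
    intro t
    obtain ⟨k, hk, -⟩ := existsUnique_sub_zsmul_mem_Ico hTpos t (-τ)
    refine ⟨k, ?_⟩
    rcases le_total (t - k • T) τ with h | h
    · exact Or.inl ⟨hk.1, h⟩
    · exact Or.inr ⟨h, by linarith [hk.2]⟩
  have cpos : ∀ t ∈ Set.Icc (-τ) τ, 0 ≤ Real.cos (sa * t) := fun t ht =>
    Real.cos_nonneg_of_mem_Icc ⟨by nlinarith [ht.1], by nlinarith [ht.2]⟩
  have spos : ∀ t ∈ Set.Icc τ (T - τ), 0 ≤ Real.sin (sb * (t - τ)) := fun t ht =>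
    Real.sin_nonneg_of_nonneg_of_le_pi (mul_nonneg sbpos.le (by linarith [ht.1]))
      (by nlinarith [ht.2])
  have base : ∀ t, (t ∈ Set.Icc (-τ) τ ∨ t ∈ Set.Icc τ (T - τ)) →
      HasDerivAt C (deriv C t) t ∧
      HasDerivAt (deriv C) (-(a * max (C t) 0 - b * max (-C t) 0)) t ∧
      deriv C t ^ 2 + a * max (C t) 0 ^ 2 + b * max (-C t) 0 ^ 2 = a := by
    intro t ht
    rcases ht with ht | ht
    · have h1 := cpos t ht
      rw [g0 t ht, (G.1 t ht).deriv, max_eq_left h1, max_eq_right (by linarith)]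
      refine ⟨G.1 t ht, ?_, ?_⟩
      · convert H.1 t ht using 1; ring
      · have := Real.sin_sq_add_cos_sq (sa * t)
        rw [← sasq]; linear_combination sa ^ 2 * this
    · have h1 := mul_nonneg (div_nonneg sapos.le sbpos.le) (spos t ht)
      rw [g1 t ht, (G.2 t ht).deriv, max_eq_right (by linarith), max_eq_left (by linarith)]
      refine ⟨G.2 t ht, ?_, ?_⟩
      · convert H.2 t ht using 1
        rw [← sbsq]; field_simp; ring
      · have := Real.sin_sq_add_cos_sq (sb * (t - τ))
        rw [← sasq, ← sbsq]; field_simp; linear_combination this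
  have full : ∀ t, HasDerivAt C (deriv C t) t ∧
      HasDerivAt (deriv C) (-(a * max (C t) 0 - b * max (-C t) 0)) t ∧
      deriv C t ^ 2 + a * max (C t) 0 ^ 2 + b * max (-C t) 0 ^ 2 = a := by
    intro t
    obtain ⟨k, hk⟩ := cover t
    obtain ⟨h1, h2, h3⟩ := base _ hk
    rw [hCp.sub_zsmul_eq, hSp.sub_zsmul_eq] at h3
    rw [hSp.sub_zsmul_eq] at h1
    rw [hCp.sub_zsmul_eq] at h2
    refine ⟨?_, ?_, h3⟩
    · exact (HasDerivAt.comp_sub_const t (k • T) h1).congr_of_eventuallyEq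
        (Eventually.of_forall fun u => (hCp.sub_zsmul_eq k).symm)
    · exact (HasDerivAt.comp_sub_const t (k • T) h2).congr_of_eventuallyEq
        (Eventually.of_forall fun u => (hSp.sub_zsmul_eq k).symm)
  refine ⟨deriv C, ha0, hb, hn0, hτpos, hτT, fun t => (full t).1, fun t => (full t).2.1,
    fun t => (full t).2.2, hper, ?_, ?_, ?_, ?_⟩
  · intro t ht
    rw [g0 t ⟨ht.1.le, ht.2.le⟩]
    exact Real.cos_pos_of_mem_Ioo ⟨by nlinarith [ht.1], by nlinarith [ht.2]⟩
  · intro t ht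
    rw [g1 t ⟨ht.1.le, ht.2.le⟩]
    have := Real.sin_pos_of_pos_of_lt_pi (x := sb * (t - τ)) (mul_pos sbpos (by linarith [ht.1]))
      (by nlinarith [ht.2])
    have := mul_pos (div_pos sapos sbpos) this
    linarith
  · have e : ∫ s in (-τ)..τ, C s = ∫ s in (-τ)..τ, Real.cos (sa * s) := by
      apply intervalIntegral.integral_congr
      intro t ht
      rw [Set.uIcc_of_le (by linarith)] at ht
      exact g0 t ht
    rw [e, intervalIntegral.integral_comp_mul_left _ sapos.ne', integral_cos, mul_neg, saτ]
    simp; field_simp; norm_num; exact mul_comm _ _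
  · have e : ∫ s in τ..(T - τ), C s = ∫ s in τ..(T - τ), -(sa / sb) * Real.sin (sb * (s - τ)) := by
      apply intervalIntegral.integral_congr
      intro t ht
      rw [Set.uIcc_of_le hτT.le] at ht
      exact g1 t ht
    rw [e, intervalIntegral.integral_const_mul,
      intervalIntegral.integral_comp_sub_right (fun x => Real.sin (sb * x)),
      intervalIntegral.integral_comp_mul_left _ sbpos.ne', integral_sin, sbT]
    simp; rw [← sbsq]; field_simp; norm_num; exact mul_comm _ _

namespace Osc

variable {n : ℕ} {a b τ : ℝ} {C S : ℝ → ℝ}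

lemma contC (o : Osc n a b τ C S) : Continuous C :=
  continuous_iff_continuousAt.2 fun t => (o.hC t).continuousAt

lemma contS (o : Osc n a b τ C S) : Continuous S :=
  continuous_iff_continuousAt.2 fun t => (o.hS t).continuousAt

lemma wron (o : Osc n a b τ C S) (t : ℝ) :
    S t ^ 2 + C t * (a * max (C t) 0 - b * max (-C t) 0) = a := by
  have := o.hE t
  rcases le_total 0 (C t) with h | h
  · rw [max_eq_left h, max_eq_right (by linarith)] at *; linarith
  · rw [max_eq_right h, max_eq_left (by linarith)] at *; linarith

lemma lip_of_deriv (f f' : ℝ → ℝ) (M : ℝ) (h : ∀ t, HasDerivAt f (f' t) t) (hM : ∀ t, |f' t| ≤ M)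
    (s t : ℝ) : |f s - f t| ≤ M * |s - t| := by
  have := Convex.norm_image_sub_le_of_norm_hasDerivWithin_le (f := f) (f' := f') (s := Set.univ)
    (x := t) (y := s) (C := M) (fun x _ => (h x).hasDerivWithinAt) (fun x _ => by simpa using hM x)
    convex_univ trivial trivial
  simpa using this

lemma bounds (o : Osc n a b τ C S) : ∃ M, 1 ≤ M ∧ (∀ t, |C t| ≤ M) ∧ (∀ t, |S t| ≤ M) ∧
    (∀ s t, |C s - C t| ≤ M * |s - t|) ∧ (∀ s t, |S s - S t| ≤ M * |s - t|) := by
  have ha := o.apos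
  have hb := o.bpos
  have h1 : ∀ t, |S t| ≤ 1 + a := by
    intro t
    apply abs_le_of_sq_le_sq _ (by linarith)
    have := o.hE t
    nlinarith [mul_nonneg ha.le (sq_nonneg (max (C t) 0)), mul_nonneg hb.le (sq_nonneg (max (-C t) 0))]
  have h2 : ∀ t, max (C t) 0 ≤ 1 := by
    intro t
    have := o.hE t
    have h3 : a * max (C t) 0 ^ 2 ≤ a * 1 := by
      nlinarith [sq_nonneg (S t), mul_nonneg hb.le (sq_nonneg (max (-C t) 0))]
    have h4 := le_of_mul_le_mul_left h3 ha
    nlinarith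
  have h3 : ∀ t, max (-C t) 0 ≤ 1 + a / b := by
    intro t
    have := o.hE t
    have h3 : b * max (-C t) 0 ^ 2 ≤ b * (a / b) := by
      rw [mul_div_cancel₀ _ hb.ne']
      nlinarith [sq_nonneg (S t), mul_nonneg ha.le (sq_nonneg (max (C t) 0))]
    have h4 := le_of_mul_le_mul_left h3 hb
    have : 0 < a / b := div_pos ha hb
    nlinarith
  have hab : 0 < a / b := div_pos ha hb
  have h4 : ∀ t, |C t| ≤ 1 + a / b := by
    intro t
    rw [abs_le]
    have := h3 t
    have := h2 t
    have := le_max_left (C t) 0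
    have := le_max_left (-C t) 0
    constructor <;> linarith
  have h5 : ∀ t, |-(a * max (C t) 0 - b * max (-C t) 0)| ≤ 2 * a + b := by
    intro t
    have e : b * (1 + a / b) = b + a := by field_simp
    have := mul_le_mul_of_nonneg_left (h2 t) ha.le
    have := mul_le_mul_of_nonneg_left (h3 t) hb.le
    have := mul_nonneg ha.le (le_max_right (C t) 0)
    have := mul_nonneg hb.le (le_max_right (-C t) 0)
    rw [abs_le]
    constructor <;> linarith
  refine ⟨1 + 2 * a + b + a / b, by linarith, fun t => (h4 t).trans (by linarith),
    fun t => (h1 t).trans (by linarith), ?_, ?_⟩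
  · exact lip_of_deriv C S _ o.hC fun t => (h1 t).trans (by linarith)
  · exact lip_of_deriv S _ _ o.hS fun t => (h5 t).trans (by linarith)

lemma perT (o : Osc n a b τ C S) : Function.Periodic C (2 * π / n) := o.hper

lemma perC (o : Osc n a b τ C S) : Function.Periodic C (2 * π) := by
  have := o.perT.nat_mul n
  rwa [mul_div_cancel₀ _ o.npos.ne'] at this

lemma perS (o : Osc n a b τ C S) : Function.Periodic S (2 * π) := by
  intro t
  have h1 : HasDerivAt (fun u => C (u + 2 * π)) (S (t + 2 * π)) t :=
    HasDerivAt.comp_add_const t (2 * π) (o.hC _)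
  have h2 : HasDerivAt C (S (t + 2 * π)) t :=
    h1.congr_of_eventuallyEq (Eventually.of_forall fun u => (o.perC u).symm)
  exact h2.unique (o.hC t)

lemma ae_ne (o : Osc n a b τ C S) : ∀ᵐ t, C t ≠ 0 := by
  have hT : 0 < 2 * π / n := by have := o.npos; positivity
  have hsub : {t | C t = 0} ⊆ Set.range (fun k : ℤ => -τ + k • (2 * π / n)) ∪
      Set.range (fun k : ℤ => τ + k • (2 * π / n)) := by
    intro t ht
    obtain ⟨k, hk, -⟩ := existsUnique_sub_zsmul_mem_Ico hT t (-τ)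
    have h0 : C (t - k • (2 * π / n)) = 0 := by rw [o.perT.sub_zsmul_eq]; exact ht
    rcases eq_or_lt_of_le hk.1 with h | h
    · left; exact ⟨k, by simp only; rw [h]; ring⟩
    rcases lt_trichotomy (t - k • (2 * π / n)) τ with h' | h' | h'
    · have := o.pos _ ⟨h, h'⟩; linarith
    · right; exact ⟨k, by simp only; rw [← h']; ring⟩
    · have := o.neg _ ⟨h', by linarith [hk.2]⟩; linarith
  have hc : {t | C t = 0}.Countable :=
    ((Set.countable_range _).union (Set.countable_range _)).mono hsub
  have := hc.measure_zero volume
  rw [ae_iff]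
  simpa using this

lemma small (o : Osc n a b τ C S) (ε : ℝ) (hε : 0 < ε) :
    ∃ δ > 0, ∫ t in (0 : ℝ)..(2 * π), 2 * δ / (δ + |C t|) ≤ ε := by
  have key : Tendsto (fun k : ℕ => ∫ t in (0 : ℝ)..(2 * π),
      2 * (1 / ((k : ℝ) + 1)) / (1 / ((k : ℝ) + 1) + |C t|)) atTop
      (nhds (∫ t in (0 : ℝ)..(2 * π), (0 : ℝ))) := by
    apply intervalIntegral.tendsto_integral_filter_of_dominated_convergence (fun _ => (2 : ℝ))
    · refine Eventually.of_forall fun k => Continuous.aestronglyMeasurable ?_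
      have := o.contC
      refine Continuous.div (by fun_prop) (by fun_prop) fun t => ?_
      have : 0 < 1 / ((k : ℝ) + 1) := by positivity
      positivity
    · refine Eventually.of_forall fun k => Eventually.of_forall fun t _ => ?_
      have : 0 < 1 / ((k : ℝ) + 1) := by positivity
      rw [Real.norm_eq_abs, abs_of_nonneg (by positivity), div_le_iff₀ (by positivity)]
      nlinarith [abs_nonneg (C t)]
    · simp
    · filter_upwards [o.ae_ne] with t ht _
      have h1 := tendsto_one_div_add_atTop_nhds_zero_nat (𝕜 := ℝ)
      have h2 := (h1.const_mul 2).div (h1.add_const |C t|) (by simpa using ht)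
      rw [mul_zero, zero_add, zero_div] at h2
      exact h2
  rw [intervalIntegral.integral_zero] at key
  obtain ⟨k, hk⟩ := (key.eventually (gt_mem_nhds hε)).exists
  exact ⟨1 / ((k : ℝ) + 1), by positivity, hk.le⟩

end Osc

lemma shift_int (h : ℝ → ℝ) (hp : Function.Periodic h (2 * π)) (η : ℝ) :
    ∫ t in (0 : ℝ)..(2 * π), h (t + η) = ∫ t in (0 : ℝ)..(2 * π), h t := by
  rw [intervalIntegral.integral_comp_add_right]
  have := hp.intervalIntegral_add_eq η 0
  rw [zero_add] at *
  rw [← this, add_comm]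

lemma restoring_lip (a b : ℝ) (ha : 0 < a) (hb : 0 < b) (q : ℝ → ℝ) (t : ℝ) :
    LipschitzWith (Real.toNNReal (1 + a + b))
      (fun z : ℝ × ℝ => (z.2, q t - a * max z.1 0 + b * max (-z.1) 0)) := by
  apply LipschitzWith.of_dist_le_mul
  intro z w
  rw [Real.coe_toNNReal _ (by linarith), dist_eq_norm, dist_eq_norm]
  have h1 : |z.1 - w.1| ≤ ‖z - w‖ := by simpa using norm_fst_le (z - w)
  have h2 : |z.2 - w.2| ≤ ‖z - w‖ := by simpa using norm_snd_le (z - w)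
  have hN : 0 ≤ ‖z - w‖ := norm_nonneg _
  have m1 : |max z.1 0 - max w.1 0| ≤ |z.1 - w.1| := abs_max_sub_max_le_abs _ _ _
  have m2 : |max (-z.1) 0 - max (-w.1) 0| ≤ |z.1 - w.1| := by
    have := abs_max_sub_max_le_abs (-z.1) (-w.1) 0
    rwa [show -z.1 - -w.1 = -(z.1 - w.1) by ring, abs_neg] at this
  rw [Prod.norm_def]
  apply max_le
  · simp only [Prod.fst_sub, Real.norm_eq_abs]
    nlinarith [mul_nonneg ha.le hN, mul_nonneg hb.le hN]
  · simp only [Prod.snd_sub, Real.norm_eq_abs]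
    have e : q t - a * max z.1 0 + b * max (-z.1) 0 - (q t - a * max w.1 0 + b * max (-w.1) 0) =
      -(a * (max z.1 0 - max w.1 0)) + b * (max (-z.1) 0 - max (-w.1) 0) := by ring
    rw [e]
    refine (abs_add_le _ _).trans ?_
    rw [abs_neg, abs_mul, abs_mul, abs_of_pos ha, abs_of_pos hb]
    have := mul_le_mul_of_nonneg_left (m1.trans h1) ha.le
    have := mul_le_mul_of_nonneg_left (m2.trans h1) hb.le
    linarith

/-- existence of generalized polar coordinates for the forced equation with forcing `q` -/
lemma polar_ode {n : ℕ} {a b τ : ℝ} {C S : ℝ → ℝ} (o : Osc n a b τ C S) (M B : ℝ) (hB : 0 ≤ B)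
    (hM1 : 1 ≤ M) (hMC : ∀ t, |C t| ≤ M) (hMS : ∀ t, |S t| ≤ M)
    (hLC : ∀ s t, |C s - C t| ≤ M * |s - t|) (hLS : ∀ s t, |S s - S t| ≤ M * |s - t|)
    (q : ℝ → ℝ) (hq : ContinuousOn q (Set.Icc 0 (2 * π)))
    (hqB : ∀ t ∈ Set.Icc 0 (2 * π), |q t| ≤ B) (r0 η0 : ℝ) :
    ∃ r η : ℝ → ℝ, r 0 = r0 ∧ η 0 = η0 ∧ ∀ t ∈ Set.Icc 0 (2 * π),
      HasDerivWithinAt r (q t * S (t + η t) / a) (Set.Icc 0 (2 * π)) t ∧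
      HasDerivWithinAt η (-(q t * C (t + η t) / (a * max (r t) 1))) (Set.Icc 0 (2 * π)) t := by
  have ha := o.apos
  have hpi : (0 : ℝ) ≤ 2 * π := by positivity
  set L := B * M / a with hL
  have hL0 : 0 ≤ L := by positivity
  have hPL : IsPicardLindelof
      (fun (t : ℝ) (z : ℝ × ℝ) => (q t * S (t + z.2) / a, -(q t * C (t + z.2) / (a * max z.1 1))))
      (tmin := 0) (tmax := 2 * π) ⟨0, le_refl _, hpi⟩ (r0, η0)
      (Real.toNNReal (L * (2 * π))) 0 (Real.toNNReal L) (Real.toNNReal (2 * L)) := by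
    refine ⟨?_, ?_, ?_, ?_⟩
    · intro t ht
      apply LipschitzWith.lipschitzOnWith
      apply LipschitzWith.of_dist_le_mul
      intro z w
      rw [Real.coe_toNNReal _ (by positivity), dist_eq_norm, dist_eq_norm]
      have h1 : |z.1 - w.1| ≤ ‖z - w‖ := by simpa using norm_fst_le (z - w)
      have h2 : |z.2 - w.2| ≤ ‖z - w‖ := by simpa using norm_snd_le (z - w)
      have hN : 0 ≤ ‖z - w‖ := norm_nonneg _
      have hqt := hqB t ht
      rw [Prod.norm_def]
      apply max_le
      · simp only [Prod.fst_sub, Real.norm_eq_abs]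
        rw [← sub_div, ← mul_sub, abs_div, abs_mul, abs_of_pos ha, div_le_iff₀ ha]
        have h3 := hLS (t + z.2) (t + w.2)
        rw [add_sub_add_left_eq_sub] at h3
        have h4 : |S (t + z.2) - S (t + w.2)| ≤ M * ‖z - w‖ :=
          h3.trans (mul_le_mul_of_nonneg_left h2 (by linarith))
        have h5 := mul_le_mul hqt h4 (abs_nonneg _) hB
        have h6 : 2 * L * ‖z - w‖ * a = 2 * (B * (M * ‖z - w‖)) := by rw [hL]; field_simp
        have : 0 ≤ B * (M * ‖z - w‖) := by positivity
        linarith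
      · simp only [Prod.snd_sub, Real.norm_eq_abs]
        have mz : 1 ≤ max z.1 1 := le_max_right _ _
        have mw : 1 ≤ max w.1 1 := le_max_right _ _
        have mzw : |max w.1 1 - max z.1 1| ≤ ‖z - w‖ := by
          rw [abs_sub_comm]
          exact (abs_max_sub_max_le_abs _ _ _).trans h1
        set m := max z.1 1
        set m' := max w.1 1
        have e : -(q t * C (t + z.2) / (a * m)) - -(q t * C (t + w.2) / (a * m')) =
          -(q t / a * ((C (t + z.2) - C (t + w.2)) / m + C (t + w.2) * (m' - m) / (m * m'))) := by
          field_simp; ring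
        rw [e, abs_neg, abs_mul, abs_div, abs_of_pos ha]
        have h3 := hLC (t + z.2) (t + w.2)
        rw [add_sub_add_left_eq_sub] at h3
        have h4 : |(C (t + z.2) - C (t + w.2)) / m| ≤ M * ‖z - w‖ := by
          rw [abs_div, abs_of_pos (by linarith : 0 < m)]
          exact (div_le_self (abs_nonneg _) mz).trans
            (h3.trans (mul_le_mul_of_nonneg_left h2 (by linarith)))
        have h5 : |C (t + w.2) * (m' - m) / (m * m')| ≤ M * ‖z - w‖ := by
          rw [abs_div, abs_mul, abs_of_pos (by positivity : 0 < m * m')]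
          refine (div_le_self (by positivity) (by nlinarith)).trans ?_
          exact mul_le_mul (hMC _) mzw (abs_nonneg _) (by linarith)
        have h6 : |(C (t + z.2) - C (t + w.2)) / m + C (t + w.2) * (m' - m) / (m * m')| ≤
            2 * M * ‖z - w‖ := (abs_add_le _ _).trans (by linarith)
        have h7 : |q t| / a ≤ B / a := by gcongr
        have h8 := mul_le_mul h7 h6 (abs_nonneg _) (by positivity)
        have h9 : B / a * (2 * M * ‖z - w‖) = 2 * L * ‖z - w‖ := by rw [hL]; field_simp
        linarith
    · intro z _
      have m1 : 1 ≤ max z.1 1 := le_max_right _ _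
      have hCc := o.contC
      have hSc := o.contS
      refine ContinuousOn.prodMk ?_ ?_
      · exact (hq.mul (hSc.comp (continuous_id.add continuous_const)).continuousOn).div_const _
      · exact ((hq.mul (hCc.comp (continuous_id.add continuous_const)).continuousOn).div_const _).neg
    · intro t ht z _
      rw [Real.coe_toNNReal _ hL0, Prod.norm_def]
      have m1 : 1 ≤ max z.1 1 := le_max_right _ _
      apply max_le
      · simp only [Real.norm_eq_abs]
        rw [abs_div, abs_mul, abs_of_pos ha, hL]
        gcongr
        · exact hqB t ht
        · exact hMS _
      · simp only [Real.norm_eq_abs]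
        rw [abs_neg, abs_div, abs_mul, abs_of_pos (by positivity : 0 < a * max z.1 1), hL]
        gcongr
        · exact hqB t ht
        · exact hMC _
        · nlinarith
    · simp [Real.coe_toNNReal _ hL0, hpi]
  obtain ⟨α, hα0, hα⟩ := hPL.exists_eq_forall_mem_Icc_hasDerivWithinAt₀
  refine ⟨fun t => (α t).1, fun t => (α t).2, ?_, ?_, fun t ht => ⟨(hα t ht).fst, (hα t ht).snd⟩⟩
  · exact congrArg Prod.fst hα0
  · exact congrArg Prod.snd hα0

/-- generalized polar coordinates along a solution on one period -/
lemma polar {n : ℕ} {a b τ : ℝ} {C S : ℝ → ℝ} (o : Osc n a b τ C S) (B : ℝ) (hB : 0 ≤ B) :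
    ∃ c > 0, ∀ (q x v : ℝ → ℝ) (r0 η0 : ℝ), ContinuousOn q (Set.Icc 0 (2 * π)) →
      (∀ t ∈ Set.Icc 0 (2 * π), |q t| ≤ B) →
      (∀ t ∈ Set.Icc 0 (2 * π), HasDerivAt x (v t) t ∧
        HasDerivAt v (q t - a * max (x t) 0 + b * max (-x t) 0) t) →
      c ≤ r0 → x 0 = r0 * C η0 → v 0 = r0 * S η0 →
      ∃ r η : ℝ → ℝ, ContinuousOn r (Set.Icc 0 (2 * π)) ∧ ContinuousOn η (Set.Icc 0 (2 * π)) ∧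
        r 0 = r0 ∧ η 0 = η0 ∧
        (∀ t ∈ Set.Icc 0 (2 * π), x t = r t * C (t + η t) ∧ v t = r t * S (t + η t) ∧
          |r t - r0| ≤ c ∧ r0 / 2 ≤ r t ∧ |η t - η0| ≤ c / r0) ∧
        r (2 * π) - r0 = ∫ t in (0 : ℝ)..(2 * π), q t * S (t + η t) / a ∧
        η (2 * π) - η0 = ∫ t in (0 : ℝ)..(2 * π), -(q t * C (t + η t) / (a * r t)) := by
  obtain ⟨M, hM1, hMC, hMS, hLC, hLS⟩ := o.bounds
  have ha := o.apos
  have hpi : (0 : ℝ) ≤ 2 * π := by positivity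
  set L := B * M / a with hL
  have hL0 : 0 ≤ L := by positivity
  set c1 := L * (2 * π) with hc1
  have hc10 : 0 ≤ c1 := by positivity
  refine ⟨2 * c1 + 2, by positivity, ?_⟩
  intro q x v r0 η0 hq hqB hx hr0 hx0 hv0
  obtain ⟨r, η, hr, hη, hd⟩ := polar_ode o M B hB hM1 hMC hMS hLC hLS q hq hqB r0 η0
  have hrc : ContinuousOn r (Set.Icc 0 (2 * π)) := fun t ht => (hd t ht).1.continuousWithinAt
  have hηc : ContinuousOn η (Set.Icc 0 (2 * π)) := fun t ht => (hd t ht).2.continuousWithinAt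
  have hrb : ∀ t ∈ Set.Icc 0 (2 * π), |r t - r0| ≤ c1 := by
    intro t ht
    have := norm_image_sub_le_of_norm_deriv_le_segment' (f := r)
      (f' := fun t => q t * S (t + η t) / a) (C := L) (fun t ht => (hd t ht).1) (fun t ht => by
        rw [Real.norm_eq_abs, abs_div, abs_mul, abs_of_pos ha, hL]
        gcongr
        · exact hqB t ⟨ht.1, ht.2.le⟩
        · exact hMS _) t ht
    rw [hr, Real.norm_eq_abs, sub_zero] at this
    exact this.trans (mul_le_mul_of_nonneg_left ht.2 hL0)
  have hr2 : ∀ t ∈ Set.Icc 0 (2 * π), r0 / 2 ≤ r t := by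
    intro t ht
    have := (abs_le.1 (hrb t ht)).1
    linarith
  have hr1 : ∀ t ∈ Set.Icc 0 (2 * π), max (r t) 1 = r t := by
    intro t ht
    have := hr2 t ht
    exact max_eq_left (by linarith)
  have hr0pos : 0 < r0 := by linarith
  have hrpos : ∀ t ∈ Set.Icc 0 (2 * π), 0 < r t := fun t ht => by have := hr2 t ht; linarith
  have hηb : ∀ t ∈ Set.Icc 0 (2 * π), |η t - η0| ≤ (2 * c1 + 2) / r0 := by
    intro t ht
    have := norm_image_sub_le_of_norm_deriv_le_segment' (f := η)
      (f' := fun t => -(q t * C (t + η t) / (a * max (r t) 1))) (C := B * M / (a * (r0 / 2)))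
      (fun t ht => (hd t ht).2) (fun t ht => by
        have ht' : t ∈ Set.Icc 0 (2 * π) := ⟨ht.1, ht.2.le⟩
        rw [hr1 t ht']
        have := hrpos t ht'
        rw [Real.norm_eq_abs, abs_neg, abs_div, abs_mul, abs_of_pos (by positivity : 0 < a * r t)]
        gcongr
        · exact hqB t ht'
        · exact hMC _
        · exact hr2 t ht') t ht
    rw [hη, Real.norm_eq_abs, sub_zero] at this
    refine this.trans ?_
    have h1 : B * M / (a * (r0 / 2)) = 2 * L / r0 := by rw [hL]; field_simp
    rw [h1, div_mul_eq_mul_div]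
    gcongr
    have := mul_le_mul_of_nonneg_left ht.2 hL0
    linarith
  have hpolar : Set.EqOn (fun t => (x t, v t)) (fun t => (r t * C (t + η t), r t * S (t + η t)))
      (Set.Icc 0 (2 * π)) := by
    have hD : ∀ t ∈ Set.Icc 0 (2 * π),
        HasDerivWithinAt (fun t => (r t * C (t + η t), r t * S (t + η t)))
        (r t * S (t + η t), q t - a * max (r t * C (t + η t)) 0 + b * max (-(r t * C (t + η t))) 0)
        (Set.Icc 0 (2 * π)) t := by
      intro t ht
      obtain ⟨d1, d2⟩ := hd t ht
      rw [hr1 t ht] at d2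
      have hrp := hrpos t ht
      have dψ := (hasDerivWithinAt_id t (Set.Icc 0 (2 * π))).add d2
      have dC := (o.hC (t + η t)).comp_hasDerivWithinAt t dψ
      have dS := (o.hS (t + η t)).comp_hasDerivWithinAt t dψ
      have hw := o.wron (t + η t)
      have e1 : max (r t * C (t + η t)) 0 = r t * max (C (t + η t)) 0 := by
        rw [mul_max_of_nonneg _ _ hrp.le, mul_zero]
      have e2 : max (-(r t * C (t + η t))) 0 = r t * max (-C (t + η t)) 0 := by
        rw [mul_max_of_nonneg _ _ hrp.le, mul_zero, mul_neg]
      rw [e1, e2]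
      refine HasDerivWithinAt.prodMk ?_ ?_
      · refine (d1.mul dC).congr_deriv ?_
        simp only [Function.comp]
        field_simp
        simp [mul_assoc]
      · refine (d1.mul dS).congr_deriv ?_
        simp only [Function.comp, Pi.add_apply, id]
        set c := C (t + η t)
        set s := S (t + η t)
        set F := max c 0
        set G := max (-c) 0
        have : q t * s / a * s + r t * (-(a * F - b * G) * (1 + -(q t * c / (a * r t)))) =
          q t / a * (s ^ 2 + c * (a * F - b * G)) - a * (r t * F) + b * (r t * G) := by
          field_simp; ring
        rw [this, hw]; field_simp
    refine ODE_solution_unique (K := Real.toNNReal (1 + a + b))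
      (v := fun t z => (z.2, q t - a * max z.1 0 + b * max (-z.1) 0))
      (restoring_lip a b ha o.bpos q) ?_ ?_ ?_ ?_ ?_
    · intro t ht
      exact ((hx t ht).1.continuousAt.prodMk (hx t ht).2.continuousAt).continuousWithinAt
    · intro t ht
      have h := hx t ⟨ht.1, ht.2.le⟩
      exact (h.1.prodMk h.2).hasDerivWithinAt
    · exact fun t ht => (hD t ht).continuousWithinAt
    · intro t ht
      exact (hD t ⟨ht.1, ht.2.le⟩).mono_of_mem_nhdsWithin (Icc_mem_nhdsGE_of_mem ht)
    · simp [hx0, hv0, hr, hη]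
  have hψc : ContinuousOn (fun t => t + η t) (Set.Icc 0 (2 * π)) := continuousOn_id.add hηc
  have hSψ := o.contS.comp_continuousOn hψc
  have hCψ := o.contC.comp_continuousOn hψc
  refine ⟨r, η, hrc, hηc, hr, hη, fun t ht => ⟨congrArg Prod.fst (hpolar ht),
    congrArg Prod.snd (hpolar ht), (hrb t ht).trans (by linarith), hr2 t ht, hηb t ht⟩, ?_, ?_⟩
  · rw [intervalIntegral.integral_eq_sub_of_hasDerivAt_of_le hpi hrc
      (fun t ht => (hd t ⟨ht.1.le, ht.2.le⟩).1.hasDerivAt (Icc_mem_nhds ht.1 ht.2)), hr]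
    apply ContinuousOn.intervalIntegrable
    rw [Set.uIcc_of_le hpi]
    exact (hq.mul hSψ).div_const _
  · rw [intervalIntegral.integral_eq_sub_of_hasDerivAt_of_le hpi hηc
      (fun t ht => by
        have := (hd t ⟨ht.1.le, ht.2.le⟩).2
        rw [hr1 t ⟨ht.1.le, ht.2.le⟩] at this
        exact this.hasDerivAt (Icc_mem_nhds ht.1 ht.2)), hη]
    apply ContinuousOn.intervalIntegrable
    rw [Set.uIcc_of_le hpi]
    refine ((hq.mul hCψ).div (continuousOn_const.mul hrc) fun t ht => ?_).neg
    exact (mul_pos ha (hrpos t ht)).ne'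

def sg (c : ℝ) : ℝ := if 0 < c then 1 else -1

lemma sg_abs (c : ℝ) : |sg c| = 1 := by unfold sg; split_ifs <;> simp

lemma sg_meas : Measurable sg := Measurable.ite measurableSet_Ioi measurable_const measurable_const

lemma sg_int (C : ℝ → ℝ) (hC : Continuous C) (u w : ℝ) :
    IntervalIntegrable (fun t => sg (C t)) volume u w := by
  refine (intervalIntegrable_const (c := (1 : ℝ))).mono_fun
    (sg_meas.comp hC.measurable).aestronglyMeasurable ?_
  refine Eventually.of_forall fun t => ?_
  simp [sg_abs]

lemma sign_avg {n : ℕ} {a b τ : ℝ} {C S : ℝ → ℝ} (o : Osc n a b τ C S)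
    (φ : ℝ → ℝ) (hφ : Continuous φ) (M : ℝ) (hM : ∀ x, |φ x| ≤ M) (l : ℝ)
    (ht : Tendsto φ atTop (nhds l)) (hb : Tendsto φ atBot (nhds (-l)))
    (ε : ℝ) (hε : 0 < ε) (c : ℝ) (hc : 0 ≤ c) :
    ∃ R > 0, ∀ r ≥ R, ∀ η : ℝ, ∀ y : ℝ → ℝ, ContinuousOn y (Set.Icc 0 (2 * π)) →
      (∀ t ∈ Set.Icc 0 (2 * π), |y t - r * C (t + η)| ≤ c) →
      ∫ t in (0 : ℝ)..(2 * π), |φ (y t) - l * sg (C (t + η))| ≤ ε := by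
  have hM0 : 0 ≤ M := (abs_nonneg _).trans (hM 0)
  have hpi : (0 : ℝ) ≤ 2 * π := by positivity
  have hl : |l| ≤ M := le_of_tendsto ht.abs (Eventually.of_forall hM)
  obtain ⟨δ, hδ, hδε⟩ := o.small (ε / (4 * (M + 1))) (by positivity)
  have hε1 : 0 < ε / (4 * π) := by positivity
  obtain ⟨X1, hX1⟩ := eventually_atTop.1 (Metric.tendsto_nhds.1 ht _ hε1)
  obtain ⟨X2, hX2⟩ := eventually_atBot.1 (Metric.tendsto_nhds.1 hb _ hε1)
  set X := max (max X1 (-X2)) 1 with hX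
  have hXpos : 1 ≤ X := le_max_right _ _
  have hXX1 : X1 ≤ X := (le_max_left _ _).trans (le_max_left _ _)
  have hXX2 : -X2 ≤ X := (le_max_right _ _).trans (le_max_left _ _)
  refine ⟨(X + c) / δ, by positivity, ?_⟩
  intro r hr η y hy hyc
  have hrδ : X + c ≤ r * δ := (div_le_iff₀ hδ).1 hr
  have hr0 : 0 < r := lt_of_lt_of_le (by positivity) hr
  have pt : ∀ t ∈ Set.Icc 0 (2 * π), |φ (y t) - l * sg (C (t + η))| ≤
      ε / (4 * π) + 2 * M * (2 * δ / (δ + |C (t + η)|)) := by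
    intro t ht
    have h1 := abs_le.1 (hyc t ht)
    have hnn : 0 ≤ 2 * M * (2 * δ / (δ + |C (t + η)|)) := by positivity
    by_cases hs : |C (t + η)| < δ
    · have h2 : 1 ≤ 2 * δ / (δ + |C (t + η)|) := by
        rw [le_div_iff₀ (by positivity)]; linarith
      have h3 : |φ (y t) - l * sg (C (t + η))| ≤ 2 * M := by
        refine (abs_sub _ _).trans ?_
        rw [abs_mul, sg_abs]
        linarith [hM (y t)]
      nlinarith
    · push Not at hs
      rcases le_total 0 (C (t + η)) with hp | hp
      · rw [abs_of_nonneg hp] at hs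
        have h2 : X ≤ y t := by nlinarith
        have h3 := hX1 (y t) (hXX1.trans h2)
        rw [Real.dist_eq] at h3
        rw [sg, if_pos (by linarith), mul_one]
        linarith
      · rw [abs_of_nonpos hp] at hs
        have h2 : y t ≤ -X := by nlinarith
        have h3 := hX2 (y t) (by linarith)
        rw [Real.dist_eq] at h3
        rw [sg, if_neg (by linarith), mul_neg, mul_one]
        linarith
  have hCη : Continuous fun t => C (t + η) := o.contC.comp (continuous_id.add continuous_const)
  have hhc : Continuous fun t => 2 * δ / (δ + |C (t + η)|) := by
    refine Continuous.div continuous_const (continuous_const.add hCη.abs) fun t => ?_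
    positivity
  have i1 : IntervalIntegrable (fun t => |φ (y t) - l * sg (C (t + η))|) volume 0 (2 * π) := by
    refine (IntervalIntegrable.sub ?_ ((sg_int _ hCη _ _).const_mul l)).abs
    apply ContinuousOn.intervalIntegrable
    rw [Set.uIcc_of_le hpi]
    exact hφ.comp_continuousOn hy
  have i2 : IntervalIntegrable (fun t => 2 * M * (2 * δ / (δ + |C (t + η)|))) volume 0 (2 * π) :=
    (hhc.const_mul _).intervalIntegrable _ _
  have := intervalIntegral.integral_mono_on hpi i1 (intervalIntegrable_const.add i2) pt
  refine this.trans ?_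
  rw [intervalIntegral.integral_add intervalIntegrable_const i2, intervalIntegral.integral_const,
    intervalIntegral.integral_const_mul,
    shift_int (fun t => 2 * δ / (δ + |C t|)) (fun t => by simp only [o.perC t]) η]
  have e1 : (2 * π - 0) • (ε / (4 * π)) = ε / 2 := by
    rw [smul_eq_mul]; field_simp; ring
  have e2 : 2 * M * ∫ t in (0 : ℝ)..(2 * π), 2 * δ / (δ + |C t|) ≤ ε / 2 := by
    refine (mul_le_mul_of_nonneg_left hδε (by positivity)).trans ?_
    rw [mul_div_assoc', div_le_iff₀ (by positivity)]
    nlinarith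
  rw [e1]; linarith

lemma weight (q q' W W0 : ℝ → ℝ) (B κ β ε : ℝ) (hB : 0 ≤ B) (hβ : 0 ≤ β)
    (hq : ContinuousOn q (Set.Icc 0 (2 * π))) (hW : ContinuousOn W (Set.Icc 0 (2 * π)))
    (hW0 : Continuous W0) (hq' : IntervalIntegrable q' volume 0 (2 * π))
    (hqB : ∀ t ∈ Set.Icc 0 (2 * π), |q t| ≤ B)
    (hWW : ∀ t ∈ Set.Icc 0 (2 * π), |W t - W0 t| ≤ κ)
    (hWβ : ∀ t, |W0 t| ≤ β) (hε : ∫ t in (0 : ℝ)..(2 * π), |q t - q' t| ≤ ε) :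
    |(∫ t in (0 : ℝ)..(2 * π), q t * W t) - ∫ t in (0 : ℝ)..(2 * π), q' t * W0 t| ≤
      2 * π * (B * κ) + β * ε := by
  have hpi : (0 : ℝ) ≤ 2 * π := by positivity
  have ic : ∀ f : ℝ → ℝ, ContinuousOn f (Set.Icc 0 (2 * π)) → IntervalIntegrable f volume 0 (2 * π) := by
    intro f hf
    apply ContinuousOn.intervalIntegrable
    rwa [Set.uIcc_of_le hpi]
  have i1 : IntervalIntegrable (fun t => q t * W t) volume 0 (2 * π) := ic _ (hq.mul hW)
  have i2 : IntervalIntegrable (fun t => q' t * W0 t) volume 0 (2 * π) :=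
    hq'.mul_continuousOn hW0.continuousOn
  have i3 : IntervalIntegrable (fun t => |q t - q' t|) volume 0 (2 * π) := ((ic _ hq).sub hq').abs
  rw [← intervalIntegral.integral_sub i1 i2]
  refine (intervalIntegral.abs_integral_le_integral_abs hpi).trans ?_
  have pt : ∀ t ∈ Set.Icc 0 (2 * π), |q t * W t - q' t * W0 t| ≤ B * κ + β * |q t - q' t| := by
    intro t ht
    rw [show q t * W t - q' t * W0 t = q t * (W t - W0 t) + W0 t * (q t - q' t) by ring]
    refine (abs_add_le _ _).trans ?_
    rw [abs_mul, abs_mul]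
    exact add_le_add (mul_le_mul (hqB t ht) (hWW t ht) (abs_nonneg _) hB)
      (mul_le_mul_of_nonneg_right (hWβ t) (abs_nonneg _))
  refine (intervalIntegral.integral_mono_on hpi (i1.sub i2).abs
    (intervalIntegrable_const.add (i3.const_mul β)) pt).trans ?_
  rw [intervalIntegral.integral_add intervalIntegrable_const (i3.const_mul β),
    intervalIntegral.integral_const, intervalIntegral.integral_const_mul, smul_eq_mul, sub_zero]
  have := mul_le_mul_of_nonneg_left hε hβ
  linarith

/-- averaged forcing against the weight `w` -/
def avg (C' p : ℝ → ℝ) (l : ℝ) (w : ℝ → ℝ) (η₁ η₂ : ℝ) : ℝ :=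
  ∫ t in (0 : ℝ)..(2 * π), (p t - l * sg (C' (t + η₂))) * w (t + η₁)

/-- the one-period estimate for the first component -/
lemma one_step {n : ℕ} {a b τ a' b' τ' : ℝ} {C S C' S' : ℝ → ℝ} (o : Osc n a b τ C S)
    (o' : Osc n a' b' τ' C' S')
    (φ : ℝ → ℝ) (hφ : Continuous φ) (M : ℝ) (hM : ∀ x, |φ x| ≤ M) (l : ℝ)
    (ht : Tendsto φ atTop (nhds l)) (hb : Tendsto φ atBot (nhds (-l)))
    (p : ℝ → ℝ) (hp : Continuous p) (P B' : ℝ) (hP : ∀ t, |p t| ≤ P) (hB' : 0 ≤ B')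
    (ε : ℝ) (hε : 0 < ε) :
    ∃ R > 0, ∀ (x v x' v' q' : ℝ → ℝ) (r η r' η' : ℝ), R ≤ r → R ≤ r' →
      ContinuousOn q' (Set.Icc 0 (2 * π)) → (∀ t ∈ Set.Icc 0 (2 * π), |q' t| ≤ B') →
      (∀ t ∈ Set.Icc 0 (2 * π), HasDerivAt x (v t) t ∧
        HasDerivAt v (p t - φ (x' t) - a * max (x t) 0 + b * max (-x t) 0) t) →
      (∀ t ∈ Set.Icc 0 (2 * π), HasDerivAt x' (v' t) t ∧
        HasDerivAt v' (q' t - a' * max (x' t) 0 + b' * max (-x' t) 0) t) →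
      x 0 = r * C η → v 0 = r * S η → x' 0 = r' * C' η' → v' 0 = r' * S' η' →
      (∀ t ∈ Set.Icc 0 (2 * π), ∃ ρ ψ, r / 2 ≤ ρ ∧ x t = ρ * C ψ ∧ v t = ρ * S ψ) ∧
      ∃ r₁ η₁, x (2 * π) = r₁ * C η₁ ∧ v (2 * π) = r₁ * S η₁ ∧
        |r₁ - r - avg C' p l S η η' / a| ≤ ε ∧ |r * (η₁ - η) + avg C' p l C η η' / a| ≤ ε := by
  have hpi : (0 : ℝ) ≤ 2 * π := by positivity
  have hM0 : 0 ≤ M := (abs_nonneg _).trans (hM 0)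
  have hP0 : 0 ≤ P := (abs_nonneg _).trans (hP 0)
  have ha := o.apos
  set B := P + M with hBdef
  have hB : 0 ≤ B := by positivity
  obtain ⟨c, hc, hpol⟩ := polar o B hB
  obtain ⟨c', hc', hpol'⟩ := polar o' B' hB'
  obtain ⟨M1, hM1, hMC, hMS, hLC, hLS⟩ := o.bounds
  obtain ⟨M2, hM2, hMC', hMS', hLC', hLS'⟩ := o'.bounds
  obtain ⟨R0, hR0, hsign⟩ := sign_avg o' φ hφ M hM l ht hb (ε * a / (2 * M1)) (by positivity)
    (2 * c' * M2) (by positivity)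
  set R1 := 2 * π * (B * (3 * M1 * c)) / (ε * a / 2) with hR1
  refine ⟨max (max c c') (max R0 R1), lt_of_lt_of_le hc ((le_max_left _ _).trans (le_max_left _ _)), ?_⟩
  intro x v x' v' q' r η r' η' hr hr' hq' hqB' hx hx' x0 v0 x0' v0'
  have hcr : c ≤ r := ((le_max_left _ _).trans (le_max_left _ _)).trans hr
  have hcr' : c' ≤ r' := ((le_max_right _ _).trans (le_max_left _ _)).trans hr'
  have hRr' : R0 ≤ r' := ((le_max_left _ _).trans (le_max_right _ _)).trans hr'
  have hRr : R1 ≤ r := ((le_max_right _ _).trans (le_max_right _ _)).trans hr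
  have hr0 : 0 < r := by linarith
  have hr0' : 0 < r' := by linarith
  have hx'c : ContinuousOn x' (Set.Icc 0 (2 * π)) := fun t ht => (hx' t ht).1.continuousAt.continuousWithinAt
  have hqc : ContinuousOn (fun t => p t - φ (x' t)) (Set.Icc 0 (2 * π)) :=
    hp.continuousOn.sub (hφ.comp_continuousOn hx'c)
  have hqB : ∀ t ∈ Set.Icc 0 (2 * π), |p t - φ (x' t)| ≤ B := fun t _ =>
    (abs_sub _ _).trans (add_le_add (hP t) (hM _))
  obtain ⟨ρ, θ, hρc, hθc, hρ0, hθ0, hrep, hρ, hθ⟩ := hpol (fun t => p t - φ (x' t)) x v r η hqc hqB hx hcr x0 v0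
  obtain ⟨ρ', θ', hρc', hθc', hρ0', hθ0', hrep', -, -⟩ := hpol' q' x' v' r' η' hq' hqB' hx' hcr' x0' v0'
  have hclose : ∀ t ∈ Set.Icc 0 (2 * π), |x' t - r' * C' (t + η')| ≤ 2 * c' * M2 := by
    intro t ht
    obtain ⟨h1, -, h2, -, h3⟩ := hrep' t ht
    rw [h1, show ρ' t * C' (t + θ' t) - r' * C' (t + η') = (ρ' t - r') * C' (t + θ' t) +
      r' * (C' (t + θ' t) - C' (t + η')) by ring]
    refine (abs_add_le _ _).trans ?_
    rw [abs_mul, abs_mul, abs_of_pos hr0']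
    have h4 := hLC' (t + θ' t) (t + η')
    rw [add_sub_add_left_eq_sub] at h4
    have h5 := mul_le_mul h2 (hMC' (t + θ' t)) (abs_nonneg _) hc'.le
    have h6 : r' * |C' (t + θ' t) - C' (t + η')| ≤ r' * (M2 * (c' / r')) :=
      mul_le_mul_of_nonneg_left (h4.trans (mul_le_mul_of_nonneg_left h3 (by linarith))) hr0'.le
    have h7 : r' * (M2 * (c' / r')) = c' * M2 := by field_simp
    linarith
  have hsg := hsign r' hRr' η' x' hx'c hclose
  have hsg2 : ∫ t in (0 : ℝ)..(2 * π), |(p t - φ (x' t)) - (p t - l * sg (C' (t + η')))| ≤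
      ε * a / (2 * M1) := by
    refine le_trans (le_of_eq ?_) hsg
    congr 1
    funext t
    rw [abs_sub_comm (φ (x' t))]; congr 1; ring
  have hCη' : Continuous fun t => C' (t + η') := o'.contC.comp (continuous_id.add continuous_const)
  have hqi : IntervalIntegrable (fun t => p t - l * sg (C' (t + η'))) volume 0 (2 * π) :=
    (hp.intervalIntegrable _ _).sub ((sg_int _ hCη' _ _).const_mul l)
  have hψc : ContinuousOn (fun t => t + θ t) (Set.Icc 0 (2 * π)) := continuousOn_id.add hθc
  have hSψ : ContinuousOn (fun t => S (t + θ t)) (Set.Icc 0 (2 * π)) := o.contS.comp_continuousOn hψc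
  have hCψ : ContinuousOn (fun t => C (t + θ t)) (Set.Icc 0 (2 * π)) := o.contC.comp_continuousOn hψc
  have hSη : Continuous fun t => S (t + η) := o.contS.comp (continuous_id.add continuous_const)
  have hCη : Continuous fun t => C (t + η) := o.contC.comp (continuous_id.add continuous_const)
  have hρpos : ∀ t ∈ Set.Icc 0 (2 * π), 0 < ρ t := fun t ht => by
    have := (hrep t ht).2.2.2.1; linarith
  have final : 2 * π * (B * (3 * M1 * c / r)) + M1 * (ε * a / (2 * M1)) ≤ ε * a := by
    have h1 : M1 * (ε * a / (2 * M1)) = ε * a / 2 := by field_simp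
    have h2 : 2 * π * (B * (3 * M1 * c / r)) = 2 * π * (B * (3 * M1 * c)) / r := by ring
    have h3 : 2 * π * (B * (3 * M1 * c)) / r ≤ ε * a / 2 := by
      rw [div_le_iff₀ hr0]
      have := (div_le_iff₀ (by positivity)).1 hRr
      linarith
    rw [h1, h2]; linarith
  have hMc : 0 ≤ M1 * c / r := by positivity
  have w1 := weight (fun t => p t - φ (x' t)) (fun t => p t - l * sg (C' (t + η')))
    (fun t => S (t + θ t)) (fun t => S (t + η)) B (3 * M1 * c / r) M1 (ε * a / (2 * M1)) hB
    (by linarith) hqc hSψ hSη hqi hqB (fun t ht => by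
      have h4 := hLS (t + θ t) (t + η)
      rw [add_sub_add_left_eq_sub] at h4
      have h5 := mul_le_mul_of_nonneg_left (hrep t ht).2.2.2.2 (by linarith : 0 ≤ M1)
      have e1 : M1 * (c / r) = M1 * c / r := by ring
      have e2 : 3 * M1 * c / r = 3 * (M1 * c / r) := by ring
      linarith) (fun t => hMS _) hsg2
  have w2 := weight (fun t => p t - φ (x' t)) (fun t => p t - l * sg (C' (t + η')))
    (fun t => C (t + θ t) * (r / ρ t)) (fun t => C (t + η)) B (3 * M1 * c / r) M1 (ε * a / (2 * M1)) hB
    (by linarith) hqc (hCψ.mul (continuousOn_const.div hρc fun t ht => (hρpos t ht).ne')) hCη hqi hqB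
    (fun t ht => by
      have hρt := hρpos t ht
      obtain ⟨-, -, g1, g2, g3⟩ := hrep t ht
      have h4 := hLC (t + θ t) (t + η)
      rw [add_sub_add_left_eq_sub] at h4
      have h5 := mul_le_mul_of_nonneg_left g3 (by linarith : 0 ≤ M1)
      have e1 : M1 * (c / r) = M1 * c / r := by ring
      have e2 : 3 * M1 * c / r = 3 * (M1 * c / r) := by ring
      have e3 : C (t + θ t) * (r / ρ t) - C (t + η) = C (t + θ t) * ((r - ρ t) / ρ t) +
        (C (t + θ t) - C (t + η)) := by field_simp; ring
      rw [e3]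
      refine (abs_add_le _ _).trans ?_
      have h6 : |C (t + θ t) * ((r - ρ t) / ρ t)| ≤ M1 * (c / (r / 2)) := by
        rw [abs_mul, abs_div, abs_of_pos hρt, abs_sub_comm]
        refine mul_le_mul (hMC _) ?_ (by positivity) (by linarith)
        gcongr
      have e4 : M1 * (c / (r / 2)) = 2 * (M1 * c / r) := by field_simp
      linarith) (fun t => hMC _) hsg2
  refine ⟨fun t ht => ⟨ρ t, t + θ t, (hrep t ht).2.2.2.1, (hrep t ht).1, (hrep t ht).2.1⟩,
    ρ (2 * π), θ (2 * π), ?_, ?_, ?_, ?_⟩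
  · rw [(hrep _ ⟨hpi, le_refl _⟩).1, add_comm, o.perC]
  · rw [(hrep _ ⟨hpi, le_refl _⟩).2.1, add_comm, o.perS]
  · rw [hρ, intervalIntegral.integral_div, ← sub_div, abs_div, abs_of_pos ha, div_le_iff₀ ha]
    exact w1.trans final
  · have e : r * (θ (2 * π) - η) = -((∫ t in (0 : ℝ)..(2 * π), (p t - φ (x' t)) *
        (C (t + θ t) * (r / ρ t))) / a) := by
      rw [hθ, ← intervalIntegral.integral_const_mul, ← intervalIntegral.integral_div,
        ← intervalIntegral.integral_neg]
      congr 1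
      funext t
      ring
    rw [e, neg_add_eq_sub, ← sub_div, abs_div, abs_of_pos ha, div_le_iff₀ ha, abs_sub_comm]
    exact w2.trans final

lemma avg_split {n : ℕ} {a' b' τ' : ℝ} {C' S' : ℝ → ℝ} (o' : Osc n a' b' τ' C' S')
    (p : ℝ → ℝ) (hp : Continuous p) (l : ℝ) (w : ℝ → ℝ) (hw : Continuous w)
    (hwp : Function.Periodic w (2 * π)) (η η' : ℝ) :
    avg C' p l w η η' = (∫ t in (0 : ℝ)..(2 * π), p t * w (t + η)) -
      l * ∫ t in (0 : ℝ)..(2 * π), sg (C' t) * w (t + (η - η')) := by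
  have hCη' : Continuous fun t => C' (t + η') := o'.contC.comp (continuous_id.add continuous_const)
  have hwη : Continuous fun t => w (t + η) := hw.comp (continuous_id.add continuous_const)
  have h1 := shift_int (fun t => sg (C' t) * w (t + (η - η'))) (fun t => by
    have e : t + 2 * π + (η - η') = t + (η - η') + 2 * π := by ring
    simp only [o'.perC t, e, hwp (t + (η - η'))]) η'
  rw [← h1, ← intervalIntegral.integral_const_mul, ← intervalIntegral.integral_sub]
  · unfold avg
    congr 1
    funext t
    rw [show t + η' + (η - η') = t + η by ring]
    ring
  · exact (hp.mul hwη).intervalIntegrable _ _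
  · simp only [add_assoc, add_sub_cancel]
    exact ((sg_int _ hCη' _ _).mul_continuousOn hwη.continuousOn).const_mul l

lemma sg_avg {n : ℕ} {a b τ a' b' τ' : ℝ} {C S C' S' : ℝ → ℝ} (o : Osc n a b τ C S)
    (o' : Osc n a' b' τ' C' S') (s : ℝ) :
    ∫ t in (0 : ℝ)..(2 * π), sg (C' t) * C (t + s) =
      2 * n * ((∫ t in (s - τ')..(s + τ'), C t) - (1 / √a - √a / b)) := by
  have hn := o.npos
  have hCs : Continuous fun t => C (t + s) := o.contC.comp (continuous_id.add continuous_const)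
  have hii : ∀ u w, IntervalIntegrable (fun t => sg (C' t) * C (t + s)) volume u w := fun u w =>
    (sg_int _ o'.contC u w).mul_continuousOn hCs.continuousOn
  have hCi : ∀ u w, IntervalIntegrable (fun t => C (t + s)) volume u w := fun u w =>
    hCs.intervalIntegrable u w
  have hper : Function.Periodic (fun t => sg (C' t) * C (t + s)) (2 * π / n) := by
    intro t
    have e : t + 2 * π / n + s = t + s + 2 * π / n := by ring
    simp only [o'.hper t, e, o.hper (t + s)]
  have h1 : ∫ t in (0 : ℝ)..(2 * π), sg (C' t) * C (t + s) =
      n * ∫ t in (-τ')..(2 * π / n - τ'), sg (C' t) * C (t + s) := by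
    have h2 := hper.intervalIntegral_add_zsmul_eq n 0 (fun u w => hii u w)
    have h3 := hper.intervalIntegral_add_eq 0 (-τ')
    rw [h3] at h2
    simp only [natCast_zsmul, nsmul_eq_mul, zero_add] at h2
    rw [mul_div_cancel₀ _ hn.ne'] at h2
    rw [h2]
    congr 2
    ring
  have hτ := o'.τpos
  have hτ2 := o'.τlt
  rw [h1, ← intervalIntegral.integral_add_adjacent_intervals (hii (-τ') τ') (hii τ' _)]
  have e1 : ∫ t in (-τ')..τ', sg (C' t) * C (t + s) = ∫ t in (-τ')..τ', C (t + s) := by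
    apply intervalIntegral.integral_congr_ae
    have : ∀ᵐ t : ℝ, t ≠ τ' := by simp [ae_iff]
    filter_upwards [this] with t ht hm
    rw [Set.uIoc_of_le (by linarith)] at hm
    rw [sg, if_pos (o'.pos t ⟨hm.1, lt_of_le_of_ne hm.2 ht⟩), one_mul]
  have e2 : ∫ t in τ'..(2 * π / n - τ'), sg (C' t) * C (t + s) =
      -∫ t in τ'..(2 * π / n - τ'), C (t + s) := by
    rw [← intervalIntegral.integral_neg]
    apply intervalIntegral.integral_congr_ae
    have : ∀ᵐ t : ℝ, t ≠ 2 * π / n - τ' := by simp [ae_iff]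
    filter_upwards [this] with t ht hm
    rw [Set.uIoc_of_le (by linarith)] at hm
    have := o'.neg t ⟨hm.1, lt_of_le_of_ne hm.2 ht⟩
    rw [sg, if_neg (by linarith)]
    ring
  have e3 := intervalIntegral.integral_add_adjacent_intervals (hCi (-τ') τ') (hCi τ' (2 * π / n - τ'))
  have e4 : ∫ t in (-τ')..(2 * π / n - τ'), C (t + s) = 2 * (1 / √a - √a / b) := by
    have g1 := o.perT.intervalIntegral_add_eq (-τ' + s) (-τ)
    have g2 := intervalIntegral.integral_add_adjacent_intervals
      (o.contC.intervalIntegrable (μ := volume) (-τ) τ) (o.contC.intervalIntegrable τ (2 * π / n - τ))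
    rw [intervalIntegral.integral_comp_add_right]
    rw [o.int0, o.int1] at g2
    rw [show 2 * π / n - τ' + s = -τ' + s + 2 * π / n by ring, g1,
      show -τ + 2 * π / n = 2 * π / n - τ by ring, ← g2]
    ring
  have e5 : ∫ t in (-τ')..τ', C (t + s) = ∫ t in (s - τ')..(s + τ'), C t := by
    rw [intervalIntegral.integral_comp_add_right]
    congr 1 <;> ring
  rw [e1, e2, ← e5]
  rw [e4] at e3
  have e6 : ∫ t in τ'..(2 * π / n - τ'), C (t + s) =
    2 * (1 / √a - √a / b) - ∫ t in (-τ')..τ', C (t + s) := by linarith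
  rw [e6]; ring

lemma L_avg {n : ℕ} {a b τ a' b' τ' : ℝ} {C S C' S' : ℝ → ℝ} (o : Osc n a b τ C S)
    (o' : Osc n a' b' τ' C' S') (p : ℝ → ℝ) (hp : Continuous p) (l γ α : ℝ)
    (hα : α = 1 / √a - √a / b) (K Λ Φ : ℝ → ℝ) (hK : ∀ t, K t = ∫ s in (0 : ℝ)..t, C s)
    (hΛ : ∀ t, Λ t = K (t / n + τ') - K (t / n - τ'))
    (hΦ : ∀ θ, Φ θ = -(γ / 2) * ∫ t in (0 : ℝ)..(2 * π), C (θ / n + t) * p t) (θ θ' : ℝ) :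
    Φ θ + γ * n * l * (Λ (θ - θ') - α) = -(γ / 2) * avg C' p l C (θ / n) (θ' / n) := by
  rw [avg_split o' p hp l C o.contC o.perC, sg_avg o o', hΦ, hΛ, hK, hK, ← hα,
    intervalIntegral.integral_interval_sub_left (o.contC.intervalIntegrable _ _)
      (o.contC.intervalIntegrable _ _), ← sub_div]
  have : ∀ t, C (θ / n + t) * p t = p t * C (t + θ / n) := fun t => by rw [add_comm, mul_comm]
  simp only [this]
  ring

lemma avg_deriv {n : ℕ} {a b τ a' b' τ' : ℝ} {C S C' S' : ℝ → ℝ} (o : Osc n a b τ C S)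
    (o' : Osc n a' b' τ' C' S') (p : ℝ → ℝ) (hp : Continuous p) (l η η' : ℝ) :
    HasDerivAt (fun η => avg C' p l C η η') (avg C' p l S η η') η := by
  obtain ⟨M, hM, hMC, hMS, hLC, hLS⟩ := o.bounds
  have hCη' : Continuous fun t => C' (t + η') := o'.contC.comp (continuous_id.add continuous_const)
  have hq : IntervalIntegrable (fun t => p t - l * sg (C' (t + η'))) volume 0 (2 * π) :=
    (hp.intervalIntegrable _ _).sub ((sg_int _ hCη' _ _).const_mul l)
  have hsh : ∀ w : ℝ → ℝ, Continuous w → ∀ x, Continuous fun t => w (t + x) := fun w hw x =>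
    hw.comp (continuous_id.add continuous_const)
  refine (intervalIntegral.hasDerivAt_integral_of_dominated_loc_of_deriv_le (s := Set.univ)
    (F := fun η t => (p t - l * sg (C' (t + η'))) * C (t + η))
    (F' := fun η t => (p t - l * sg (C' (t + η'))) * S (t + η))
    (bound := fun t => |p t - l * sg (C' (t + η'))| * M) univ_mem ?_ ?_ ?_ ?_ ?_ ?_).2
  · refine Eventually.of_forall fun x => ?_
    exact (hq.mul_continuousOn (hsh C o.contC x).continuousOn).def'.aestronglyMeasurable
  · exact hq.mul_continuousOn (hsh C o.contC η).continuousOn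
  · exact (hq.mul_continuousOn (hsh S o.contS η).continuousOn).def'.aestronglyMeasurable
  · refine Eventually.of_forall fun t _ x _ => ?_
    rw [Real.norm_eq_abs, abs_mul]
    exact mul_le_mul_of_nonneg_left (hMS _) (abs_nonneg _)
  · exact hq.abs.mul_const M
  · refine Eventually.of_forall fun t _ x _ => ?_
    exact (HasDerivAt.comp_const_add t x (o.hC (t + x))).const_mul _

lemma lip_int (q w : ℝ → ℝ) (B M : ℝ) (hw : Continuous w)
    (hq : IntervalIntegrable q volume 0 (2 * π)) (hqB : ∀ t, |q t| ≤ B)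
    (hL : ∀ s t, |w s - w t| ≤ M * |s - t|) (η ζ : ℝ) :
    |(∫ t in (0 : ℝ)..(2 * π), q t * w (t + η)) - ∫ t in (0 : ℝ)..(2 * π), q t * w (t + ζ)| ≤
      2 * π * B * M * |η - ζ| := by
  have hsh : ∀ x, Continuous fun t => w (t + x) := fun x =>
    hw.comp (continuous_id.add continuous_const)
  have hB : 0 ≤ B := (abs_nonneg _).trans (hqB 0)
  rw [← intervalIntegral.integral_sub (hq.mul_continuousOn (hsh η).continuousOn)
    (hq.mul_continuousOn (hsh ζ).continuousOn)]
  have := intervalIntegral.norm_integral_le_of_norm_le_const (a := 0) (b := 2 * π)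
    (f := fun t => q t * w (t + η) - q t * w (t + ζ)) (C := B * (M * |η - ζ|)) (fun t _ => by
      rw [Real.norm_eq_abs, ← mul_sub, abs_mul]
      have := hL (t + η) (t + ζ)
      rw [add_sub_add_left_eq_sub] at this
      exact mul_le_mul (hqB t) this (abs_nonneg _) hB)
  have h9 : |2 * π - 0| = 2 * π := by rw [sub_zero, abs_of_pos (by positivity)]
  rw [Real.norm_eq_abs, h9] at this
  refine this.trans (le_of_eq ?_)
  ring

lemma avg_lip {n : ℕ} {a b τ a' b' τ' : ℝ} {C S C' S' : ℝ → ℝ} (o : Osc n a b τ C S)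
    (o' : Osc n a' b' τ' C' S') (p : ℝ → ℝ) (hp : Continuous p) (P : ℝ) (hP : ∀ t, |p t| ≤ P)
    (l : ℝ) : ∃ K > 0, ∀ η η' ζ ζ' : ℝ,
      |avg C' p l S η η' - avg C' p l S ζ ζ'| ≤ K * (|η - ζ| + |η' - ζ'|) := by
  obtain ⟨M, hM, hMC, hMS, hLC, hLS⟩ := o.bounds
  have hP0 : 0 ≤ P := (abs_nonneg _).trans (hP 0)
  refine ⟨2 * π * P * M + |l| * (2 * π * 1 * M) + 1, by positivity, fun η η' ζ ζ' => ?_⟩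
  rw [avg_split o' p hp l S o.contS o.perS, avg_split o' p hp l S o.contS o.perS]
  have h1 := lip_int p S P M o.contS (hp.intervalIntegrable _ _) hP hLS η ζ
  have h2 := lip_int (fun t => sg (C' t)) S 1 M o.contS (sg_int _ o'.contC _ _)
    (fun t => (sg_abs _).le) hLS (η - η') (ζ - ζ')
  set A := ∫ t in (0 : ℝ)..(2 * π), p t * S (t + η)
  set A' := ∫ t in (0 : ℝ)..(2 * π), p t * S (t + ζ)
  set D := ∫ t in (0 : ℝ)..(2 * π), sg (C' t) * S (t + (η - η'))
  set D' := ∫ t in (0 : ℝ)..(2 * π), sg (C' t) * S (t + (ζ - ζ'))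
  rw [show A - l * D - (A' - l * D') = (A - A') - l * (D - D') by ring]
  refine (abs_sub _ _).trans ?_
  rw [abs_mul]
  have h3 : |η - η' - (ζ - ζ')| ≤ |η - ζ| + |η' - ζ'| := by
    rw [show η - η' - (ζ - ζ') = (η - ζ) - (η' - ζ') by ring]
    exact abs_sub _ _
  have h4 : 0 ≤ 2 * π * 1 * M := by positivity
  have h5 := mul_le_mul_of_nonneg_left (h2.trans (mul_le_mul_of_nonneg_left h3 h4)) (abs_nonneg l)
  have h6 : 2 * π * P * M * |η - ζ| ≤ 2 * π * P * M * (|η - ζ| + |η' - ζ'|) := by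
    refine mul_le_mul_of_nonneg_left ?_ (by positivity)
    linarith [abs_nonneg (η' - ζ')]
  have h7 := abs_nonneg (η - ζ)
  have h8 := abs_nonneg (η' - ζ')
  linarith

/-- the one-period map in the coordinates adapted to a zero of the resonance function -/
lemma comp_step {n : ℕ} {a b τ a' b' τ' : ℝ} {C S C' S' : ℝ → ℝ} (o : Osc n a b τ C S)
    (o' : Osc n a' b' τ' C' S')
    (φ : ℝ → ℝ) (hφ : Continuous φ) (M : ℝ) (hM : ∀ x, |φ x| ≤ M) (l : ℝ)
    (ht : Tendsto φ atTop (nhds l)) (hb : Tendsto φ atBot (nhds (-l)))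
    (p : ℝ → ℝ) (hp : Continuous p) (P B' : ℝ) (hP : ∀ t, |p t| ≤ P) (hB' : 0 ≤ B')
    (γ lam m w w' g' : ℝ) (hγ : 0 < γ) (hγa : γ ^ 2 * a = 2 * n) (hlam : 0 < lam) (hg' : 0 < g')
    (G : ℝ → ℝ → ℝ) (hG : ∀ θ θ', G θ θ' = -(γ / 2) * avg C' p l C (θ / n) (θ' / n))
    (hG1 : HasDerivAt (fun θ => G θ w') (-lam) w)
    (hD : ∀ κ > 0, ∃ δ > 0, ∀ z z' : ℝ, |z - w| ≤ δ → |z' - w'| ≤ δ →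
      |G z z' / lam - (-(z - w) + m * (z' - w'))| ≤ κ * max |z - w| |z' - w'|)
    (κ : ℝ) (hκ : 0 < κ) :
    ∃ δ₀ > 0, ∀ δ > 0, δ ≤ δ₀ →
    ∃ R > 0, ∀ (x v x' v' q' : ℝ → ℝ) (u θ u' θ' : ℝ), R ≤ u → R ≤ u' →
      |θ - w| ≤ δ → |θ' - w'| ≤ δ →
      ContinuousOn q' (Set.Icc 0 (2 * π)) → (∀ t ∈ Set.Icc 0 (2 * π), |q' t| ≤ B') →
      (∀ t ∈ Set.Icc 0 (2 * π), HasDerivAt x (v t) t ∧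
        HasDerivAt v (p t - φ (x' t) - a * max (x t) 0 + b * max (-x t) 0) t) →
      (∀ t ∈ Set.Icc 0 (2 * π), HasDerivAt x' (v' t) t ∧
        HasDerivAt v' (q' t - a' * max (x' t) 0 + b' * max (-x' t) 0) t) →
      x 0 = γ * lam * u * C (θ / n) → v 0 = γ * lam * u * S (θ / n) →
      x' 0 = g' * u' * C' (θ' / n) → v' 0 = g' * u' * S' (θ' / n) →
      (∀ t ∈ Set.Icc 0 (2 * π), ∃ ρ ψ, γ * lam * u / 2 ≤ ρ ∧ x t = ρ * C ψ ∧ v t = ρ * S ψ) ∧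
      ∃ u₁ θ₁, x (2 * π) = γ * lam * u₁ * C (θ₁ / n) ∧ v (2 * π) = γ * lam * u₁ * S (θ₁ / n) ∧
        |u₁ - u - 1| ≤ κ ∧ |u * (θ₁ - θ) - (-(θ - w) + m * (θ' - w'))| ≤ κ * δ := by
  have hn := o.npos
  have ha := o.apos
  obtain ⟨K, hK, hKl⟩ := avg_lip o o' p hp P hP l
  have hgl : 0 < γ * lam := by positivity
  have hSw : avg C' p l S (w / n) (w' / n) = 2 * n * lam / γ := by
    have h1 := avg_deriv o o' p hp l (w / n) (w' / n)
    have h2 : HasDerivAt (fun θ : ℝ => θ / n) (1 / n : ℝ) w := (hasDerivAt_id' w).div_const _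
    have h3 := (h1.scomp_of_eq w h2 rfl).const_mul (-(γ / 2))
    have h4 := h3.unique (hG1.congr_of_eventuallyEq (Eventually.of_forall fun θ => by
      simp only [hG, Function.comp]))
    rw [smul_eq_mul] at h4
    field_simp at h4 ⊢
    linarith
  have hSa : avg C' p l S (w / n) (w' / n) / a = γ * lam := by
    rw [hSw, ← hγa]; field_simp
  obtain ⟨δ₁, hδ₁, hδD⟩ := hD (κ / 2) (by positivity)
  refine ⟨min δ₁ (κ * (γ * lam) * a * n / (4 * K)), by positivity, fun δ hδ hδ0 => ?_⟩
  have hδ1 : δ ≤ δ₁ := hδ0.trans (min_le_left _ _)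
  have hδ2 : δ * (4 * K) ≤ κ * (γ * lam) * a * n :=
    (le_div_iff₀ (by positivity)).1 (hδ0.trans (min_le_right _ _))
  obtain ⟨R, hR, hstep⟩ := one_step o o' φ hφ M hM l ht hb p hp P B' hP hB'
    (min (κ * (γ * lam) / 2) (κ * δ * (γ * lam) / (2 * n))) (by positivity)
  refine ⟨max (R / (γ * lam)) (R / g'), lt_max_of_lt_left (by positivity), ?_⟩
  intro x v x' v' q' u θ u' θ' hu hu' hθ hθ' hq' hqB' hx hx' x0 v0 x0' v0'
  have hr : R ≤ γ * lam * u := by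
    have := (div_le_iff₀ hgl).1 ((le_max_left _ _).trans hu); linarith
  have hr' : R ≤ g' * u' := by
    have := (div_le_iff₀ hg').1 ((le_max_right _ _).trans hu'); linarith
  obtain ⟨h1, r₁, η₁, hx1, hv1, hr1, hη1⟩ := hstep x v x' v' q' (γ * lam * u) (θ / n) (g' * u') (θ' / n)
    hr hr' hq' hqB' hx hx' x0 v0 x0' v0'
  refine ⟨h1, r₁ / (γ * lam), n * η₁, ?_, ?_, ?_, ?_⟩
  · rw [mul_div_cancel₀ _ hgl.ne', mul_div_cancel_left₀ _ hn.ne', hx1]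
  · rw [mul_div_cancel₀ _ hgl.ne', mul_div_cancel_left₀ _ hn.ne', hv1]
  · have h2 := hKl (θ / n) (θ' / n) (w / n) (w' / n)
    rw [← sub_div, ← sub_div, abs_div, abs_div, abs_of_pos hn] at h2
    have h3 : |avg C' p l S (θ / n) (θ' / n) / a - γ * lam| ≤ κ * (γ * lam) / 2 := by
      rw [← hSa, ← sub_div, abs_div, abs_of_pos ha, div_le_iff₀ ha]
      refine h2.trans ?_
      have h4 : |θ - w| / n + |θ' - w'| / n ≤ 2 * δ / n := by
        rw [← add_div]; gcongr; linarith
      refine (mul_le_mul_of_nonneg_left h4 hK.le).trans ?_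
      rw [mul_div_assoc', div_le_iff₀ hn, hSa]
      linarith
    have h5 := hr1.trans (min_le_left _ _)
    have h6 : r₁ / (γ * lam) - u - 1 = ((r₁ - γ * lam * u - avg C' p l S (θ / n) (θ' / n) / a) +
      (avg C' p l S (θ / n) (θ' / n) / a - γ * lam)) / (γ * lam) := by field_simp; ring
    rw [h6, abs_div, abs_of_pos hgl, div_le_iff₀ hgl]
    refine (abs_add_le _ _).trans ?_
    linarith
  · have h2 := hδD θ θ' (hθ.trans hδ1) (hθ'.trans hδ1)
    have h3 : κ / 2 * max |θ - w| |θ' - w'| ≤ κ / 2 * δ :=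
      mul_le_mul_of_nonneg_left (max_le hθ hθ') (by positivity)
    have h4 := hη1.trans (min_le_right _ _)
    have h5 : avg C' p l C (θ / n) (θ' / n) / a = -(γ * G θ θ' / n) := by
      rw [hG, div_eq_iff ha.ne']
      field_simp
      linear_combination (avg C' p l C (θ / n) (θ' / n)) * (-hγa)
    rw [h5] at h4
    have h6 : u * (n * η₁ - θ) - G θ θ' / lam =
      (γ * lam * u * (η₁ - θ / n) + -(γ * G θ θ' / n)) * (n / (γ * lam)) := by field_simp; ring
    have h7 : |u * (n * η₁ - θ) - G θ θ' / lam| ≤ κ * δ / 2 := by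
      rw [h6, abs_mul, abs_of_pos (by positivity : 0 < n / (γ * lam))]
      refine (mul_le_mul_of_nonneg_right h4 (by positivity)).trans (le_of_eq ?_)
      field_simp
    rw [show u * (n * η₁ - θ) - (-(θ - w) + m * (θ' - w')) = (u * (n * η₁ - θ) - G θ θ' / lam) +
      (G θ θ' / lam - (-(θ - w) + m * (θ' - w'))) by ring]
    refine (abs_add_le _ _).trans ?_
    linarith

/-- the invariant region of the discrete dynamics -/
def InvReg (δ κ R u₁ u₂ z₁ z₂ : ℝ) : Prop :=
  R ≤ u₁ ∧ R ≤ u₂ ∧ |u₁ - u₂| ≤ 2 * κ * (u₁ + u₂) ∧ z₁ ^ 2 + z₂ ^ 2 ≤ δ ^ 2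

lemma disc_aux (δ κ D y Y z d ℓ : ℝ) (hδ : 0 ≤ δ) (hκ : 0 < κ) (hκ1 : κ ≤ 1 / 4) (hD : 0 ≤ D)
    (hy : 0 < y) (hYy : |Y - y| ≤ 4 * κ * y) (hz : |z| ≤ δ) (hd : |d| ≤ D * δ)
    (hdl : |d - ℓ| ≤ κ * δ) :
    (z + Y * d) ^ 2 ≤ z ^ 2 + 2 * y * (z * ℓ) + (2 * κ + 8 * κ * D) * y * δ ^ 2 +
      4 * D ^ 2 * δ ^ 2 * y ^ 2 := by
  have h1 : |z * d * (Y - y)| ≤ δ * (D * δ) * (4 * κ * y) := by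
    rw [abs_mul, abs_mul]; gcongr
  have h2 : |z * (d - ℓ)| ≤ δ * (κ * δ) := by
    rw [abs_mul]; gcongr
  have h3 : |Y| ≤ 2 * y := by
    have := abs_le.1 hYy
    have h8 := mul_le_mul_of_nonneg_right hκ1 hy.le
    rw [abs_le]; constructor <;> linarith
  have h4 : |Y * d| ≤ 2 * y * (D * δ) := by
    rw [abs_mul]; gcongr
  have h5 : (Y * d) ^ 2 ≤ (2 * y * (D * δ)) ^ 2 := sq_le_sq' (abs_le.1 h4).1 (abs_le.1 h4).2
  have h6 := mul_le_mul_of_nonneg_left (le_of_abs_le h2) hy.le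
  have h7 := le_of_abs_le h1
  linarith

set_option maxHeartbeats 1000000 in
lemma disc_step (m₁ m₂ : ℝ) (hm : |m₁ + m₂| < 2) :
    ∃ κ > 0, κ ≤ 1 / 4 ∧ ∃ R > 0, ∀ δ ≥ 0, ∀ u₁ u₂ z₁ z₂ u₁' u₂' z₁' z₂' : ℝ,
      (∃ R' ≥ R, InvReg δ κ R' u₁ u₂ z₁ z₂) → |u₁' - u₁ - 1| ≤ κ → |u₂' - u₂ - 1| ≤ κ →
      |u₁ * (z₁' - z₁) - (-z₁ + m₁ * z₂)| ≤ κ * δ →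
      |u₂ * (z₂' - z₂) - (-z₂ + m₂ * z₁)| ≤ κ * δ →
      ∀ R', InvReg δ κ R' u₁ u₂ z₁ z₂ → InvReg δ κ (R' + 1 / 2) u₁' u₂' z₁' z₂' := by
  set c := 1 - |m₁ + m₂| / 2 with hc
  have hc0 : 0 < c := by linarith
  have hc1 : c ≤ 1 := by linarith [abs_nonneg (m₁ + m₂)]
  set D := 2 + |m₁| + |m₂| with hD
  have hD0 : 0 < D := by positivity
  refine ⟨min (1 / 4) (c / (4 + 16 * D)), by positivity, min_le_left _ _, max 2 (8 * D ^ 2 / c),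
    by positivity, ?_⟩
  set κ := min (1 / 4) (c / (4 + 16 * D)) with hκd
  have hκ0 : 0 < κ := by positivity
  have hκ1 : κ ≤ 1 / 4 := min_le_left _ _
  have hκ2 : κ * (4 + 16 * D) ≤ c := (le_div_iff₀ (by positivity)).1 (min_le_right _ _)
  rintro δ hδ u₁ u₂ z₁ z₂ u₁' u₂' z₁' z₂' ⟨R0, hR0, hRu1, hRu2, -, -⟩ h1 h2 h3 h4 R' ⟨i1, i2, i3, i4⟩
  have hu1 := hR0.trans hRu1
  have hu2 := hR0.trans hRu2
  have hu1' := max_le_iff.1 hu1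
  have hu2' := max_le_iff.1 hu2
  have hup1 : 0 < u₁ := by linarith [hu1'.1]
  have hup2 : 0 < u₂ := by linarith [hu2'.1]
  have k1 := abs_le.1 h1
  have k2 := abs_le.1 h2
  have k3 := abs_le.1 i3
  refine ⟨by linarith, by linarith, ?_, ?_⟩
  · have h5 : 2 * κ * (u₁ + u₂ + 2 - 2 * κ) ≤ 2 * κ * (u₁' + u₂') :=
      mul_le_mul_of_nonneg_left (by linarith) (by linarith)
    rw [abs_le]
    have h6 := mul_le_mul_of_nonneg_left hκ1 hκ0.le
    constructor <;> linarith
  · set u := (u₁ + u₂) / 2 with hu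
    have hup : 0 < u := by positivity
    have hu2 : 2 ≤ u := by linarith [hu1'.1, hu2'.1]
    have hcu : 8 * D ^ 2 ≤ c * u := by
      have := (div_le_iff₀ hc0).1 hu1'.2
      have := (div_le_iff₀ hc0).1 hu2'.2
      rw [hu]; linarith
    have hcone : ∀ U, 0 < U → |U - u| ≤ 2 * κ * u → |1 / U - 1 / u| ≤ 4 * κ * (1 / u) := by
      intro U hU hUu
      have hUh : u / 2 ≤ U := by
        have := (abs_le.1 hUu).1
        have := mul_le_mul_of_nonneg_right hκ1 hup.le; linarith
      rw [show 1 / U - 1 / u = -(U - u) / (U * u) by field_simp; ring, abs_div, abs_neg,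
        abs_of_pos (by positivity : 0 < U * u), div_le_iff₀ (by positivity)]
      refine hUu.trans ?_
      rw [show 4 * κ * (1 / u) * (U * u) = 4 * κ * U by field_simp]
      have := mul_le_mul_of_nonneg_left hUh hκ0.le; linarith
    have hY1 := hcone u₁ hup1 (by
      rw [hu, show u₁ - (u₁ + u₂) / 2 = (u₁ - u₂) / 2 by ring, abs_div, abs_two]; linarith)
    have hY2 := hcone u₂ hup2 (by
      rw [hu, show u₂ - (u₁ + u₂) / 2 = -((u₁ - u₂) / 2) by ring, abs_neg, abs_div, abs_two]; linarith)
    have hz1 : |z₁| ≤ δ := abs_le_of_sq_le_sq (by linarith [sq_nonneg z₂]) hδ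
    have hz2 : |z₂| ≤ δ := abs_le_of_sq_le_sq (by linarith [sq_nonneg z₁]) hδ
    have hd : ∀ (d z z' m : ℝ), |z| ≤ δ → |z'| ≤ δ → |m| ≤ |m₁| + |m₂| →
        |d - (-z + m * z')| ≤ κ * δ → |d| ≤ D * δ := by
      intro d z z' m hz hz' hm' hd
      have e : d = (d - (-z + m * z')) + (-z + m * z') := by ring
      rw [e]
      refine (abs_add_le _ _).trans ?_
      have e2 := abs_add_le (-z) (m * z')
      rw [abs_neg, abs_mul] at e2
      have e3 : |m| * |z'| ≤ (|m₁| + |m₂|) * δ := by gcongr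
      rw [hD]
      have e4 := mul_le_mul_of_nonneg_right hκ1 hδ
      linarith
    have hd1 := hd _ _ _ _ hz1 hz2 (by linarith [abs_nonneg m₂]) h3
    have hd2 := hd _ _ _ _ hz2 hz1 (by linarith [abs_nonneg m₁]) h4
    have hy : 0 < 1 / u := by positivity
    have f1 := disc_aux δ κ D (1 / u) (1 / u₁) z₁ _ _ hδ hκ0 hκ1 hD0.le hy hY1 hz1 hd1 h3
    have f2 := disc_aux δ κ D (1 / u) (1 / u₂) z₂ _ _ hδ hκ0 hκ1 hD0.le hy hY2 hz2 hd2 h4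
    rw [show z₁ + 1 / u₁ * (u₁ * (z₁' - z₁)) = z₁' by field_simp; ring] at f1
    rw [show z₂ + 1 / u₂ * (u₂ * (z₂' - z₂)) = z₂' by field_simp; ring] at f2
    set y := 1 / u with hydef
    have hyu : y * u = 1 := by rw [hydef]; field_simp
    have hy2 : 2 * y ≤ 1 := by
      have := mul_le_mul_of_nonneg_left hu2 hy.le
      linarith
    have hDy : 8 * D ^ 2 * y ≤ c := by
      have h7 := mul_le_mul_of_nonneg_left hcu hy.le
      have h8 : y * (c * u) = c := by rw [mul_left_comm, hyu, mul_one]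
      linarith
    have hzz : (m₁ + m₂) * (z₁ * z₂) ≤ |m₁ + m₂| * ((z₁ ^ 2 + z₂ ^ 2) / 2) := by
      refine (le_abs_self _).trans ?_
      rw [abs_mul]
      refine mul_le_mul_of_nonneg_left ?_ (abs_nonneg _)
      rw [abs_le]; constructor <;> nlinarith [sq_nonneg (z₁ + z₂), sq_nonneg (z₁ - z₂)]
    have hsum : z₁ * (-z₁ + m₁ * z₂) + z₂ * (-z₂ + m₂ * z₁) ≤ -c * (z₁ ^ 2 + z₂ ^ 2) := by
      rw [hc]; linarith
    have hs2 := mul_le_mul_of_nonneg_left hsum (by linarith : 0 ≤ 2 * y)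
    have hδ2 : 0 ≤ y * δ ^ 2 := by positivity
    have g1 : (z₁ ^ 2 + z₂ ^ 2) * (1 - 2 * y * c) ≤ δ ^ 2 * (1 - 2 * y * c) :=
      mul_le_mul_of_nonneg_right i4 (by
        have := mul_le_mul hy2 hc1 hc0.le zero_le_one
        linarith)
    have g2 := mul_le_mul_of_nonneg_left hκ2 hδ2
    have g3 := mul_le_mul_of_nonneg_left hDy hδ2
    linarith

lemma osc_low {n : ℕ} {a b τ : ℝ} {C S : ℝ → ℝ} (o : Osc n a b τ C S) :
    ∃ c > 0, ∀ t, c ≤ C t ^ 2 + S t ^ 2 := by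
  have ha := o.apos
  have hb := o.bpos
  refine ⟨a / (1 + a + b), by positivity, fun t => ?_⟩
  rw [div_le_iff₀ (by positivity)]
  have := o.hE t
  rcases le_total 0 (C t) with h | h
  · rw [max_eq_left h, max_eq_right (by linarith)] at this
    nlinarith [mul_nonneg hb.le (sq_nonneg (C t)), mul_nonneg ha.le (sq_nonneg (S t)),
      mul_nonneg hb.le (sq_nonneg (S t)), sq_nonneg (C t)]
  · rw [max_eq_right h, max_eq_left (by linarith)] at this
    nlinarith [mul_nonneg ha.le (sq_nonneg (C t)), mul_nonneg ha.le (sq_nonneg (S t)),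
      mul_nonneg hb.le (sq_nonneg (S t)), sq_nonneg (C t)]

/-- solutions of the coupled system on `[0, ∞)` -/
def IsSol (a₁ b₁ a₂ b₂ : ℝ) (p₁ p₂ φ₁ φ₂ x₁ x₂ v₁ v₂ : ℝ → ℝ) : Prop :=
  ∀ t ∈ Set.Ici (0 : ℝ),
    HasDerivAt x₁ (v₁ t) t ∧ HasDerivAt x₂ (v₂ t) t ∧
    HasDerivAt v₁ (p₁ t - a₁ * max (x₁ t) 0 + b₁ * max (-x₁ t) 0 - φ₁ (x₂ t)) t ∧
    HasDerivAt v₂ (p₂ t - a₂ * max (x₂ t) 0 + b₂ * max (-x₂ t) 0 - φ₂ (x₁ t)) t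

/-- the conclusion of `comp_step` -/
def CompStep (n : ℕ) (a b a' b' : ℝ) (C S C' S' φ p : ℝ → ℝ) (B' g g' m w w' κ : ℝ) : Prop :=
    ∃ δ₀ > 0, ∀ δ > 0, δ ≤ δ₀ →
    ∃ R > 0, ∀ (x v x' v' q' : ℝ → ℝ) (u θ u' θ' : ℝ), R ≤ u → R ≤ u' →
      |θ - w| ≤ δ → |θ' - w'| ≤ δ →
      ContinuousOn q' (Set.Icc 0 (2 * π)) → (∀ t ∈ Set.Icc 0 (2 * π), |q' t| ≤ B') →
      (∀ t ∈ Set.Icc 0 (2 * π), HasDerivAt x (v t) t ∧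
        HasDerivAt v (p t - φ (x' t) - a * max (x t) 0 + b * max (-x t) 0) t) →
      (∀ t ∈ Set.Icc 0 (2 * π), HasDerivAt x' (v' t) t ∧
        HasDerivAt v' (q' t - a' * max (x' t) 0 + b' * max (-x' t) 0) t) →
      x 0 = g * u * C (θ / n) → v 0 = g * u * S (θ / n) →
      x' 0 = g' * u' * C' (θ' / n) → v' 0 = g' * u' * S' (θ' / n) →
      (∀ t ∈ Set.Icc 0 (2 * π), ∃ ρ ψ, g * u / 2 ≤ ρ ∧ x t = ρ * C ψ ∧ v t = ρ * S ψ) ∧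
      ∃ u₁ θ₁, x (2 * π) = g * u₁ * C (θ₁ / n) ∧ v (2 * π) = g * u₁ * S (θ₁ / n) ∧
        |u₁ - u - 1| ≤ κ ∧ |u * (θ₁ - θ) - (-(θ - w) + m * (θ' - w'))| ≤ κ * δ

def Pol (n : ℕ) (C S : ℝ → ℝ) (g u θ x v : ℝ) : Prop :=
  x = g * u * C (θ / n) ∧ v = g * u * S (θ / n)

lemma full_step {n : ℕ} {a₁ b₁ a₂ b₂ : ℝ} {C₁ S₁ C₂ S₂ : ℝ → ℝ}
    (φ₁ φ₂ p₁ p₂ : ℝ → ℝ) (hφ₁ : Continuous φ₁) (hφ₂ : Continuous φ₂) (hp₁ : Continuous p₁)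
    (hp₂ : Continuous p₂) (M₁ M₂ P₁ P₂ : ℝ) (hM₁ : ∀ x, |φ₁ x| ≤ M₁) (hM₂ : ∀ x, |φ₂ x| ≤ M₂)
    (hP₁ : ∀ x, |p₁ x| ≤ P₁) (hP₂ : ∀ x, |p₂ x| ≤ P₂)
    (g₁ g₂ m₁ m₂ w₁ w₂ : ℝ) (hg₁ : 0 < g₁) (hg₂ : 0 < g₂) (hm : |m₁ + m₂| < 2)
    (h₁ : ∀ κ > 0, CompStep n a₁ b₁ a₂ b₂ C₁ S₁ C₂ S₂ φ₁ p₁ (P₂ + M₂) g₁ g₂ m₁ w₁ w₂ κ)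
    (h₂ : ∀ κ > 0, CompStep n a₂ b₂ a₁ b₁ C₂ S₂ C₁ S₁ φ₂ p₂ (P₁ + M₁) g₂ g₁ m₂ w₂ w₁ κ) :
    ∃ δ > 0, ∃ κ > 0, ∃ R > 0, ∀ R' ≥ R, ∀ (x₁ x₂ v₁ v₂ : ℝ → ℝ) (u₁ u₂ θ₁ θ₂ : ℝ),
      IsSol a₁ b₁ a₂ b₂ p₁ p₂ φ₁ φ₂ x₁ x₂ v₁ v₂ →
      InvReg δ κ R' u₁ u₂ (θ₁ - w₁) (θ₂ - w₂) →
      Pol n C₁ S₁ g₁ u₁ θ₁ (x₁ 0) (v₁ 0) → Pol n C₂ S₂ g₂ u₂ θ₂ (x₂ 0) (v₂ 0) →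
      (∀ t ∈ Set.Icc 0 (2 * π), ∃ ρ ψ, g₁ * R' / 2 ≤ ρ ∧ x₁ t = ρ * C₁ ψ ∧ v₁ t = ρ * S₁ ψ) ∧
      (∀ t ∈ Set.Icc 0 (2 * π), ∃ ρ ψ, g₂ * R' / 2 ≤ ρ ∧ x₂ t = ρ * C₂ ψ ∧ v₂ t = ρ * S₂ ψ) ∧
      ∃ u₁' u₂' θ₁' θ₂', InvReg δ κ (R' + 1 / 2) u₁' u₂' (θ₁' - w₁) (θ₂' - w₂) ∧
        Pol n C₁ S₁ g₁ u₁' θ₁' (x₁ (2 * π)) (v₁ (2 * π)) ∧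
        Pol n C₂ S₂ g₂ u₂' θ₂' (x₂ (2 * π)) (v₂ (2 * π)) := by
  obtain ⟨κ, hκ, -, R0, hR0, hdisc⟩ := disc_step m₁ m₂ hm
  obtain ⟨δ1, hδ1, h1⟩ := h₁ κ hκ
  obtain ⟨δ2, hδ2, h2⟩ := h₂ κ hκ
  have hδ : 0 < min δ1 δ2 := lt_min hδ1 hδ2
  set δ := min δ1 δ2 with hδd
  obtain ⟨R1, hR1, h1⟩ := h1 δ hδ (min_le_left _ _)
  obtain ⟨R2, hR2, h2⟩ := h2 δ hδ (min_le_right _ _)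
  refine ⟨δ, hδ, κ, hκ, max R0 (max R1 R2), lt_max_of_lt_left hR0, ?_⟩
  intro R' hR' x₁ x₂ v₁ v₂ u₁ u₂ θ₁ θ₂ hs hI hp1 hp2
  have hR'0 : R0 ≤ R' := (le_max_left _ _).trans hR'
  have hR'1 : R1 ≤ R' := ((le_max_left _ _).trans (le_max_right _ _)).trans hR'
  have hR'2 : R2 ≤ R' := ((le_max_right _ _).trans (le_max_right _ _)).trans hR'
  have hI0 := hI
  obtain ⟨i1, i2, i3, i4⟩ := hI
  have hz1 : |θ₁ - w₁| ≤ δ := abs_le_of_sq_le_sq (by linarith [sq_nonneg (θ₂ - w₂)]) hδ.le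
  have hz2 : |θ₂ - w₂| ≤ δ := abs_le_of_sq_le_sq (by linarith [sq_nonneg (θ₁ - w₁)]) hδ.le
  have hc1 : ContinuousOn x₁ (Set.Icc 0 (2 * π)) := fun t ht =>
    (hs t ht.1).1.continuousAt.continuousWithinAt
  have hc2 : ContinuousOn x₂ (Set.Icc 0 (2 * π)) := fun t ht =>
    (hs t ht.1).2.1.continuousAt.continuousWithinAt
  obtain ⟨A1, u₁', θ₁', e1, e2, e3, e4⟩ := h1 x₁ v₁ x₂ v₂ (fun t => p₂ t - φ₂ (x₁ t)) u₁ θ₁ u₂ θ₂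
    (hR'1.trans i1) (hR'1.trans i2) hz1 hz2 (hp₂.continuousOn.sub (hφ₂.comp_continuousOn hc1))
    (fun t _ => (abs_sub _ _).trans (add_le_add (hP₂ t) (hM₂ _)))
    (fun t ht => ⟨(hs t ht.1).1, (hs t ht.1).2.2.1.congr_deriv (by ring)⟩)
    (fun t ht => ⟨(hs t ht.1).2.1, (hs t ht.1).2.2.2.congr_deriv (by ring)⟩)
    hp1.1 hp1.2 hp2.1 hp2.2
  obtain ⟨A2, u₂', θ₂', f1, f2, f3, f4⟩ := h2 x₂ v₂ x₁ v₁ (fun t => p₁ t - φ₁ (x₂ t)) u₂ θ₂ u₁ θ₁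
    (hR'2.trans i2) (hR'2.trans i1) hz2 hz1 (hp₁.continuousOn.sub (hφ₁.comp_continuousOn hc2))
    (fun t _ => (abs_sub _ _).trans (add_le_add (hP₁ t) (hM₁ _)))
    (fun t ht => ⟨(hs t ht.1).2.1, (hs t ht.1).2.2.2.congr_deriv (by ring)⟩)
    (fun t ht => ⟨(hs t ht.1).1, (hs t ht.1).2.2.1.congr_deriv (by ring)⟩)
    hp2.1 hp2.2 hp1.1 hp1.2
  refine ⟨fun t ht => ?_, fun t ht => ?_, u₁', u₂', θ₁', θ₂', ?_, ⟨e1, e2⟩, ⟨f1, f2⟩⟩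
  · obtain ⟨ρ, ψ, hρ, hx⟩ := A1 t ht
    have := mul_le_mul_of_nonneg_left i1 hg₁.le
    exact ⟨ρ, ψ, by linarith, hx⟩
  · obtain ⟨ρ, ψ, hρ, hx⟩ := A2 t ht
    have := mul_le_mul_of_nonneg_left i2 hg₂.le
    exact ⟨ρ, ψ, by linarith, hx⟩
  · refine hdisc δ hδ.le u₁ u₂ (θ₁ - w₁) (θ₂ - w₂) u₁' u₂' _ _ ⟨R', hR'0, hI0⟩ e3 f3 ?_ ?_ R' hI0
    · rwa [sub_sub_sub_cancel_right]
    · rwa [sub_sub_sub_cancel_right]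

lemma tends_aux (C S x v : ℝ → ℝ) (c g R : ℝ) (hc : 0 < c) (hg : 0 < g) (hR : 0 < R)
    (hcs : ∀ t, c ≤ C t ^ 2 + S t ^ 2)
    (h : ∀ k : ℕ, ∀ t ∈ Set.Icc 0 (2 * π), ∃ ρ ψ, g * (R + k / 2) / 2 ≤ ρ ∧
      x (t + k * (2 * π)) = ρ * C ψ ∧ v (t + k * (2 * π)) = ρ * S ψ) :
    Tendsto (fun t => x t ^ 2 + v t ^ 2) atTop atTop := by
  have hpi : 0 < 2 * π := by positivity
  have h1 : Tendsto (fun t : ℝ => c * (g * ((⌊t / (2 * π)⌋₊ : ℕ) : ℝ) / 4) ^ 2) atTop atTop := by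
    have h2 : Tendsto (fun t : ℝ => ((⌊t / (2 * π)⌋₊ : ℕ) : ℝ)) atTop atTop :=
      tendsto_natCast_atTop_atTop.comp (tendsto_nat_floor_atTop.comp
        (tendsto_id.atTop_div_const hpi))
    exact ((tendsto_pow_atTop two_ne_zero).comp
      ((h2.const_mul_atTop hg).atTop_div_const (by norm_num))).const_mul_atTop hc
  refine tendsto_atTop_mono' _ ?_ h1
  filter_upwards [eventually_ge_atTop 0] with t ht
  set k := ⌊t / (2 * π)⌋₊
  have k1 : (k : ℝ) ≤ t / (2 * π) := Nat.floor_le (by positivity)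
  have k2 : t / (2 * π) < k + 1 := Nat.lt_floor_add_one _
  rw [le_div_iff₀ hpi] at k1
  rw [div_lt_iff₀ hpi] at k2
  obtain ⟨ρ, ψ, hρ, hx, hv⟩ := h k (t - k * (2 * π)) ⟨by linarith, by linarith⟩
  rw [sub_add_cancel] at hx hv
  rw [hx, hv, show (ρ * C ψ) ^ 2 + (ρ * S ψ) ^ 2 = (C ψ ^ 2 + S ψ ^ 2) * ρ ^ 2 by ring]
  have hk : (0 : ℝ) ≤ k := Nat.cast_nonneg k
  have h3 : g * (k : ℝ) / 4 ≤ ρ := by nlinarith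
  have h4 : (g * (k : ℝ) / 4) ^ 2 ≤ ρ ^ 2 := by gcongr
  exact mul_le_mul (hcs ψ) h4 (by positivity) (hc.le.trans (hcs ψ))

lemma escape {n : ℕ} {a₁ b₁ a₂ b₂ τ₁ τ₂ : ℝ} {C₁ S₁ C₂ S₂ : ℝ → ℝ}
    (o₁ : Osc n a₁ b₁ τ₁ C₁ S₁) (o₂ : Osc n a₂ b₂ τ₂ C₂ S₂)
    (φ₁ φ₂ p₁ p₂ : ℝ → ℝ) (hφ₁ : Continuous φ₁) (hφ₂ : Continuous φ₂) (hp₁ : Continuous p₁)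
    (hp₂ : Continuous p₂) (hp₁per : ∀ t, p₁ (t + 2 * π) = p₁ t) (hp₂per : ∀ t, p₂ (t + 2 * π) = p₂ t)
    (M₁ M₂ P₁ P₂ : ℝ) (hM₁ : ∀ x, |φ₁ x| ≤ M₁) (hM₂ : ∀ x, |φ₂ x| ≤ M₂)
    (hP₁ : ∀ x, |p₁ x| ≤ P₁) (hP₂ : ∀ x, |p₂ x| ≤ P₂)
    (g₁ g₂ m₁ m₂ w₁ w₂ : ℝ) (hg₁ : 0 < g₁) (hg₂ : 0 < g₂) (hm : |m₁ + m₂| < 2)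
    (h₁ : ∀ κ > 0, CompStep n a₁ b₁ a₂ b₂ C₁ S₁ C₂ S₂ φ₁ p₁ (P₂ + M₂) g₁ g₂ m₁ w₁ w₂ κ)
    (h₂ : ∀ κ > 0, CompStep n a₂ b₂ a₁ b₁ C₂ S₂ C₁ S₁ φ₂ p₂ (P₁ + M₁) g₂ g₁ m₂ w₂ w₁ κ) :
    ∃ δ > 0, ∃ κ > 0, ∃ R > 0, ∀ (x₁ x₂ v₁ v₂ : ℝ → ℝ) (u₁ u₂ θ₁ θ₂ : ℝ),
      IsSol a₁ b₁ a₂ b₂ p₁ p₂ φ₁ φ₂ x₁ x₂ v₁ v₂ →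
      InvReg δ κ R u₁ u₂ (θ₁ - w₁) (θ₂ - w₂) →
      Pol n C₁ S₁ g₁ u₁ θ₁ (x₁ 0) (v₁ 0) → Pol n C₂ S₂ g₂ u₂ θ₂ (x₂ 0) (v₂ 0) →
      (Tendsto (fun t => (x₁ t) ^ 2 + (v₁ t) ^ 2) atTop atTop ∧
         Tendsto (fun t => (x₂ t) ^ 2 + (v₂ t) ^ 2) atTop atTop) := by
  obtain ⟨δ, hδ, κ, hκ, R, hR, hst⟩ := full_step φ₁ φ₂ p₁ p₂ hφ₁ hφ₂ hp₁ hp₂ M₁ M₂ P₁ P₂ hM₁ hM₂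
    hP₁ hP₂ g₁ g₂ m₁ m₂ w₁ w₂ hg₁ hg₂ hm h₁ h₂
  obtain ⟨c₁, hc₁, hcs₁⟩ := osc_low o₁
  obtain ⟨c₂, hc₂, hcs₂⟩ := osc_low o₂
  refine ⟨δ, hδ, κ, hκ, R, hR, ?_⟩
  intro x₁ x₂ v₁ v₂ u₁ u₂ θ₁ θ₂ hs hI hp1 hp2
  have hshift : ∀ k : ℕ, IsSol a₁ b₁ a₂ b₂ p₁ p₂ φ₁ φ₂ (fun t => x₁ (t + k * (2 * π)))
      (fun t => x₂ (t + k * (2 * π))) (fun t => v₁ (t + k * (2 * π)))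
      (fun t => v₂ (t + k * (2 * π))) := by
    intro k t ht
    have ht0 : (0 : ℝ) ≤ t := ht
    obtain ⟨d1, d2, d3, d4⟩ := hs (t + k * (2 * π)) (Set.mem_Ici.2 (by positivity))
    have q1 : p₁ (t + k * (2 * π)) = p₁ t := Function.Periodic.nat_mul hp₁per k t
    have q2 : p₂ (t + k * (2 * π)) = p₂ t := Function.Periodic.nat_mul hp₂per k t
    rw [q1] at d3
    rw [q2] at d4
    exact ⟨d1.comp_add_const t _, d2.comp_add_const t _, d3.comp_add_const t _,
      d4.comp_add_const t _⟩
  have hind : ∀ k : ℕ, ∃ U₁ U₂ Θ₁ Θ₂, InvReg δ κ (R + k / 2) U₁ U₂ (Θ₁ - w₁) (Θ₂ - w₂) ∧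
      Pol n C₁ S₁ g₁ U₁ Θ₁ (x₁ (0 + k * (2 * π))) (v₁ (0 + k * (2 * π))) ∧
      Pol n C₂ S₂ g₂ U₂ Θ₂ (x₂ (0 + k * (2 * π))) (v₂ (0 + k * (2 * π))) := by
    intro k
    induction k with
    | zero =>
      refine ⟨u₁, u₂, θ₁, θ₂, ?_, ?_, ?_⟩
      · simpa using hI
      · simpa using hp1
      · simpa using hp2
    | succ k ih =>
      obtain ⟨U₁, U₂, Θ₁, Θ₂, j1, j2, j3⟩ := ih
      have hk : (0 : ℝ) ≤ k := Nat.cast_nonneg k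
      obtain ⟨-, -, U₁', U₂', Θ₁', Θ₂', l1, l2, l3⟩ := hst (R + k / 2) (by linarith) _ _ _ _ _ _ _ _
        (hshift k) j1 j2 j3
      refine ⟨U₁', U₂', Θ₁', Θ₂', ?_, ?_, ?_⟩
      · push_cast
        rwa [show R + ((k : ℝ) + 1) / 2 = R + k / 2 + 1 / 2 by ring]
      · push_cast
        rwa [show 0 + ((k : ℝ) + 1) * (2 * π) = 2 * π + k * (2 * π) by ring]
      · push_cast
        rwa [show 0 + ((k : ℝ) + 1) * (2 * π) = 2 * π + k * (2 * π) by ring]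
  constructor
  · refine tends_aux C₁ S₁ x₁ v₁ c₁ g₁ R hc₁ hg₁ hR hcs₁ fun k => ?_
    obtain ⟨U₁, U₂, Θ₁, Θ₂, j1, j2, j3⟩ := hind k
    have hk : (0 : ℝ) ≤ k := Nat.cast_nonneg k
    exact (hst (R + k / 2) (by linarith) _ _ _ _ _ _ _ _ (hshift k) j1 j2 j3).1
  · refine tends_aux C₂ S₂ x₂ v₂ c₂ g₂ R hc₂ hg₂ hR hcs₂ fun k => ?_
    obtain ⟨U₁, U₂, Θ₁, Θ₂, j1, j2, j3⟩ := hind k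
    have hk : (0 : ℝ) ≤ k := Nat.cast_nonneg k
    exact (hst (R + k / 2) (by linarith) _ _ _ _ _ _ _ _ (hshift k) j1 j2 j3).2.1

lemma polar_nhds {n : ℕ} {a b τ : ℝ} {C S : ℝ → ℝ} (o : Osc n a b τ C S) (g w ε : ℝ) (hg : 0 < g)
    (hε : 0 < ε) :
    {q : ℝ × ℝ | ∃ u θ, |u - 1| < ε ∧ |θ - w| < ε ∧ Pol n C S g u θ q.1 q.2} ∈
      nhds (g * C (w / n), g * S (w / n)) := by
  have hn := o.npos
  have ha := o.apos
  have sC : HasStrictDerivAt C (S (w / n)) (w / n) :=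
    hasStrictDerivAt_of_hasDerivAt_of_continuousAt (Eventually.of_forall o.hC) o.contS.continuousAt
  have cf : Continuous fun t => -(a * max (C t) 0 - b * max (-C t) 0) := by
    have := o.contC
    fun_prop
  have sS : HasStrictDerivAt S (-(a * max (C (w / n)) 0 - b * max (-C (w / n)) 0)) (w / n) :=
    hasStrictDerivAt_of_hasDerivAt_of_continuousAt (Eventually.of_forall o.hS) cf.continuousAt
  set f := a * max (C (w / n)) 0 - b * max (-C (w / n)) 0 with hf
  have hw := o.wron (w / n)
  rw [← hf] at hw
  set A := ContinuousLinearMap.fst ℝ ℝ ℝ with hA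
  set B := ContinuousLinearMap.snd ℝ ℝ ℝ with hB
  have s1 : HasStrictFDerivAt (fun z : ℝ × ℝ => g * z.1) (g • A) (1, w) :=
    (hasStrictFDerivAt_fst).const_mul g
  have s2 : HasStrictFDerivAt (fun z : ℝ × ℝ => (n : ℝ)⁻¹ * z.2) ((n : ℝ)⁻¹ • B) (1, w) :=
    (hasStrictFDerivAt_snd).const_mul (n : ℝ)⁻¹
  have hwn : w / n = (n : ℝ)⁻¹ * (w : ℝ) := by rw [div_eq_inv_mul]
  have s3 := s1.mul ((hwn ▸ sC : HasStrictDerivAt C (S (w / n)) ((n : ℝ)⁻¹ * ((1, w) : ℝ × ℝ).2)).comp_hasStrictFDerivAt (1, w) s2)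
  have s4 := s1.mul ((hwn ▸ sS : HasStrictDerivAt S (-f) ((n : ℝ)⁻¹ * ((1, w) : ℝ × ℝ).2)).comp_hasStrictFDerivAt (1, w) s2)
  have s5 := s3.prodMk s4
  have key := s5.map_nhds_eq_of_surj (by
    rw [LinearMap.range_eq_top]
    rintro ⟨x, y⟩
    refine ⟨((x * f + y * S (w / n)) / (g * a), n * ((x * S (w / n) - y * C (w / n)) / (g * a))), ?_⟩
    have e : (n : ℝ)⁻¹ * w = w / n := hwn.symm
    ext
    · simp [A, B, e]
      field_simp
      linear_combination x * hw
    · simp [A, B, e]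
      field_simp
      linear_combination y * hw)
  have hN : {z : ℝ × ℝ | |z.1 - 1| < ε ∧ |z.2 - w| < ε} ∈ nhds ((1 : ℝ), w) := by
    refine IsOpen.mem_nhds ?_ ⟨by simpa using hε, by simpa using hε⟩
    have c1 : Continuous fun z : ℝ × ℝ => |z.1 - 1| := by fun_prop
    have c2 : Continuous fun z : ℝ × ℝ => |z.2 - w| := by fun_prop
    exact (isOpen_lt c1 continuous_const).inter (isOpen_lt c2 continuous_const)
  have h2 := image_mem_map (m := fun z : ℝ × ℝ => (g * z.1 * C ((n : ℝ)⁻¹ * z.2), g * z.1 * S ((n : ℝ)⁻¹ * z.2))) hN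
  have key' : map (fun z : ℝ × ℝ => (g * z.1 * C ((n : ℝ)⁻¹ * z.2), g * z.1 * S ((n : ℝ)⁻¹ * z.2)))
    (nhds ((1 : ℝ), w)) = nhds (g * 1 * C ((n : ℝ)⁻¹ * w), g * 1 * S ((n : ℝ)⁻¹ * w)) := key
  rw [key', mul_one, ← hwn] at h2
  refine mem_of_superset h2 ?_
  rintro _ ⟨⟨u, θ⟩, ⟨hu, hθ⟩, rfl⟩
  refine ⟨u, θ, hu, hθ, ?_, ?_⟩
  · simp only [div_eq_inv_mul]
  · simp only [div_eq_inv_mul]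

lemma big_set (U : Set (ℝ × ℝ × ℝ × ℝ)) (hU : IsOpen U) (hne : U.Nonempty) (k₀ : ℕ) :
    ∃ E : Set (ℝ × ℝ × ℝ × ℝ), MeasurableSet E ∧ volume E = ⊤ ∧
      ∀ q ∈ E, ∃ k : ℕ, k₀ ≤ k ∧ 0 < k ∧ ∃ y ∈ U, q = (k : ℝ) • y := by
  have : (volume : Measure (ℝ × ℝ)).IsAddHaarMeasure :=
    inferInstanceAs ((volume : Measure ℝ).prod (volume : Measure ℝ)).IsAddHaarMeasure
  have : (volume : Measure (ℝ × ℝ × ℝ)).IsAddHaarMeasure :=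
    inferInstanceAs ((volume : Measure ℝ).prod (volume : Measure (ℝ × ℝ))).IsAddHaarMeasure
  have : (volume : Measure (ℝ × ℝ × ℝ × ℝ)).IsAddHaarMeasure :=
    inferInstanceAs ((volume : Measure ℝ).prod (volume : Measure (ℝ × ℝ × ℝ))).IsAddHaarMeasure
  have hv : volume U ≠ 0 := (hU.measure_pos volume hne).ne'
  refine ⟨⋃ k ∈ {k : ℕ | k₀ ≤ k ∧ 0 < k}, (fun y => (k : ℝ) • y) '' U, ?_, ?_, ?_⟩
  · refine (isOpen_biUnion fun k hk => ?_).measurableSet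
    have hk0 : (k : ℝ) ≠ 0 := by have := hk.2; positivity
    exact (Homeomorph.smulOfNeZero (k : ℝ) hk0).isOpenMap U hU
  · by_contra hcon
    obtain ⟨m, hm⟩ := ENNReal.exists_nat_mul_gt hv hcon
    set k := max (max m k₀) 1 with hk
    have hkmem : k ∈ {k : ℕ | k₀ ≤ k ∧ 0 < k} :=
      ⟨(le_max_right _ _).trans (le_max_left _ _), lt_of_lt_of_le one_pos (le_max_right _ _)⟩
    have h1 := measure_mono (μ := volume)
      (Set.subset_biUnion_of_mem (u := fun k : ℕ => (fun y : ℝ × ℝ × ℝ × ℝ => (k : ℝ) • y) '' U) hkmem)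
    have h2 : volume ((fun y : ℝ × ℝ × ℝ × ℝ => (k : ℝ) • y) '' U) = (k : ENNReal) ^ 4 * volume U := by
      rw [Set.image_smul, Measure.addHaar_smul]
      have : Module.finrank ℝ (ℝ × ℝ × ℝ × ℝ) = 4 := by simp
      rw [this, abs_of_nonneg (by positivity), ENNReal.ofReal_pow (by positivity),
        ENNReal.ofReal_natCast]
    have h3 : (m : ENNReal) * volume U ≤ (k : ENNReal) ^ 4 * volume U := by
      gcongr
      have h4 : m ≤ k ^ 4 := ((le_max_left _ _).trans (le_max_left _ _)).trans
        (Nat.le_self_pow (by norm_num) k)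
      exact_mod_cast h4
    rw [← h2] at h3
    exact absurd (hm.trans_le (h3.trans h1)) (lt_irrefl _)
  · intro q hq
    simp only [Set.mem_iUnion] at hq
    obtain ⟨k, hk, y, hy, rfl⟩ := hq
    exact ⟨k, hk.1, hk.2, y, hy, rfl⟩

lemma init_set {n : ℕ} {a₁ b₁ a₂ b₂ τ₁ τ₂ : ℝ} {C₁ S₁ C₂ S₂ : ℝ → ℝ}
    (o₁ : Osc n a₁ b₁ τ₁ C₁ S₁) (o₂ : Osc n a₂ b₂ τ₂ C₂ S₂) (g₁ g₂ w₁ w₂ δ κ R : ℝ)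
    (hg₁ : 0 < g₁) (hg₂ : 0 < g₂) (hδ : 0 < δ) (hκ : 0 < κ) :
    ∃ E : Set (ℝ × ℝ × ℝ × ℝ), MeasurableSet E ∧ volume E = ⊤ ∧
      ∀ q ∈ E, ∃ u₁ u₂ θ₁ θ₂, InvReg δ κ R u₁ u₂ (θ₁ - w₁) (θ₂ - w₂) ∧
        Pol n C₁ S₁ g₁ u₁ θ₁ q.1 q.2.2.1 ∧ Pol n C₂ S₂ g₂ u₂ θ₂ q.2.1 q.2.2.2 := by
  set ε := min (1 / 2) (min κ (δ / 2)) with hεd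
  have hε : 0 < ε := by positivity
  have hε1 : ε ≤ 1 / 2 := min_le_left _ _
  have hε2 : ε ≤ κ := (min_le_right _ _).trans (min_le_left _ _)
  have hε3 : ε ≤ δ / 2 := (min_le_right _ _).trans (min_le_right _ _)
  have n1 := polar_nhds o₁ g₁ w₁ ε hg₁ hε
  have n2 := polar_nhds o₂ g₂ w₂ ε hg₂ hε
  set N1 := {q : ℝ × ℝ | ∃ u θ, |u - 1| < ε ∧ |θ - w₁| < ε ∧ Pol n C₁ S₁ g₁ u θ q.1 q.2}
  set N2 := {q : ℝ × ℝ | ∃ u θ, |u - 1| < ε ∧ |θ - w₂| < ε ∧ Pol n C₂ S₂ g₂ u θ q.1 q.2}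
  have c1 : Continuous fun q : ℝ × ℝ × ℝ × ℝ => (q.1, q.2.2.1) := by fun_prop
  have c2 : Continuous fun q : ℝ × ℝ × ℝ × ℝ => (q.2.1, q.2.2.2) := by fun_prop
  set q0 : ℝ × ℝ × ℝ × ℝ := (g₁ * C₁ (w₁ / n), g₂ * C₂ (w₂ / n), g₁ * S₁ (w₁ / n), g₂ * S₂ (w₂ / n))
  have hW : (fun q : ℝ × ℝ × ℝ × ℝ => (q.1, q.2.2.1)) ⁻¹' N1 ∩
      (fun q : ℝ × ℝ × ℝ × ℝ => (q.2.1, q.2.2.2)) ⁻¹' N2 ∈ nhds q0 :=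
    inter_mem (c1.continuousAt.preimage_mem_nhds n1) (c2.continuousAt.preimage_mem_nhds n2)
  obtain ⟨U, hUs, hUo, hUq⟩ := mem_nhds_iff.1 hW
  obtain ⟨k₀, hk₀⟩ := exists_nat_ge (2 * R)
  obtain ⟨E, hE1, hE2, hE3⟩ := big_set U hUo ⟨q0, hUq⟩ k₀
  refine ⟨E, hE1, hE2, fun q hq => ?_⟩
  obtain ⟨k, hk, hk0, y, hy, rfl⟩ := hE3 q hq
  obtain ⟨⟨u₁, θ₁, hu1, hθ1, hp1⟩, ⟨u₂, θ₂, hu2, hθ2, hp2⟩⟩ := hUs hy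
  have hkR : (k₀ : ℝ) ≤ k := by exact_mod_cast hk
  have hkp : (0 : ℝ) < k := by exact_mod_cast hk0
  have l1 := abs_lt.1 hu1
  have l2 := abs_lt.1 hu2
  have l3 := abs_lt.1 hθ1
  have l4 := abs_lt.1 hθ2
  refine ⟨k * u₁, k * u₂, θ₁, θ₂, ⟨?_, ?_, ?_, ?_⟩, ⟨?_, ?_⟩, ⟨?_, ?_⟩⟩
  · nlinarith
  · nlinarith
  · rw [← mul_sub, abs_mul, abs_of_pos hkp, ← mul_add, mul_left_comm]
    refine mul_le_mul_of_nonneg_left ?_ hkp.le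
    have h1 : |u₁ - u₂| ≤ 2 * κ := by rw [abs_le]; constructor <;> linarith
    have h2 : 1 ≤ u₁ + u₂ := by linarith
    nlinarith
  · have h1 : (θ₁ - w₁) ^ 2 ≤ (δ / 2) ^ 2 := sq_le_sq' (by linarith) (by linarith)
    have h2 : (θ₂ - w₂) ^ 2 ≤ (δ / 2) ^ 2 := sq_le_sq' (by linarith) (by linarith)
    nlinarith
  · have := hp1.1
    simp only [Prod.smul_fst, smul_eq_mul] at this ⊢
    rw [this]; ring
  · have := hp1.2
    simp only [Prod.smul_fst, Prod.smul_snd, smul_eq_mul] at this ⊢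
    rw [this]; ring
  · have := hp2.1
    simp only [Prod.smul_fst, Prod.smul_snd, smul_eq_mul] at this ⊢
    rw [this]; ring
  · have := hp2.2
    simp only [Prod.smul_snd, smul_eq_mul] at this ⊢
    rw [this]; ring

lemma lin_data (L : ℝ × ℝ → ℝ) (ω : ℝ × ℝ) (hd : DifferentiableAt ℝ L ω) (h0 : L ω = 0) (κ : ℝ)
    (hκ : 0 < κ) : ∃ δ > 0, ∀ z z' : ℝ, |z - ω.1| ≤ δ → |z' - ω.2| ≤ δ →
      |L (z, z') - (fderiv ℝ L ω (1, 0) * (z - ω.1) + fderiv ℝ L ω (0, 1) * (z' - ω.2))| ≤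
        κ * max |z - ω.1| |z' - ω.2| := by
  have h1 := hd.hasFDerivAt.isLittleO.def hκ
  obtain ⟨δ, hδ, hδ2⟩ := Metric.eventually_nhds_iff.1 h1
  refine ⟨δ / 2, by positivity, fun z z' hz hz' => ?_⟩
  have h2 := @hδ2 (z, z') (by
    rw [dist_eq_norm, Prod.norm_def]
    simp only [Prod.fst_sub, Prod.snd_sub, Real.norm_eq_abs]
    exact (max_le hz hz').trans_lt (by linarith))
  have e : ((z, z') - ω : ℝ × ℝ) = (z - ω.1) • ((1 : ℝ), (0 : ℝ)) + (z' - ω.2) • ((0 : ℝ), (1 : ℝ)) := by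
    ext <;> simp
  rw [h0, sub_zero, Real.norm_eq_abs, Prod.norm_def] at h2
  rw [e, map_add, map_smul, map_smul, ← e] at h2
  simp only [Prod.fst_sub, Prod.snd_sub, Real.norm_eq_abs, smul_eq_mul] at h2
  rwa [mul_comm (fderiv ℝ L ω (1, 0)), mul_comm (fderiv ℝ L ω (0, 1))]

lemma lin_scale (G lam B z z' κ N : ℝ) (hlam : 0 < lam) (h : |G - (-lam * z + B * z')| ≤ κ * lam * N) :
    |G / lam - (-z + B / lam * z')| ≤ κ * N := by
  rw [show G / lam - (-z + B / lam * z') = (G - (-lam * z + B * z')) / lam by field_simp,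
    abs_div, abs_of_pos hlam, div_le_iff₀ hlam]
  linarith

lemma per_bdd (p : ℝ → ℝ) (hp : Continuous p) (hper : ∀ t, p (t + 2 * π) = p t) :
    ∃ P, ∀ t, |p t| ≤ P := by
  obtain ⟨P, hP⟩ := (isCompact_Icc (a := (0 : ℝ)) (b := 2 * π)).exists_bound_of_continuousOn
    hp.continuousOn
  refine ⟨P, fun t => ?_⟩
  obtain ⟨s, hs, hst⟩ := Function.Periodic.exists_mem_Ico₀ hper (by positivity) t
  rw [hst]
  simpa using hP s ⟨hs.1, hs.2.le⟩

theorem stmt11 (n : ℕ) (hn : 1 ≤ n)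
    (a₁ b₁ a₂ b₂ : ℝ)
    (ha₁ : (n : ℝ) ^ 2 / 4 < a₁) (hb₁ : 0 < b₁)
    (ha₂ : (n : ℝ) ^ 2 / 4 < a₂) (hb₂ : 0 < b₂)
    (hres₁ : 1 / Real.sqrt a₁ + 1 / Real.sqrt b₁ = 2 / (n : ℝ))
    (hres₂ : 1 / Real.sqrt a₂ + 1 / Real.sqrt b₂ = 2 / (n : ℝ))
    (C₁ C₂ : ℝ → ℝ) (hC₁ : IsAsymCos n a₁ b₁ C₁) (hC₂ : IsAsymCos n a₂ b₂ C₂)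
    (γ₁ γ₂ α₁ α₂ : ℝ)
    (hγ₁ : γ₁ = Real.sqrt (2 * n / a₁)) (hγ₂ : γ₂ = Real.sqrt (2 * n / a₂))
    (hα₁ : α₁ = 1 / Real.sqrt a₁ - Real.sqrt a₁ / b₁)
    (hα₂ : α₂ = 1 / Real.sqrt a₂ - Real.sqrt a₂ / b₂)
    (K₁ K₂ : ℝ → ℝ)
    (hK₁ : ∀ t, K₁ t = ∫ s in (0 : ℝ)..t, C₁ s)
    (hK₂ : ∀ t, K₂ t = ∫ s in (0 : ℝ)..t, C₂ s)
    (Λ₁ Λ₂ : ℝ → ℝ)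
    (hΛ₁ : ∀ t, Λ₁ t = K₁ (t / n + π / (2 * Real.sqrt a₂)) - K₁ (t / n - π / (2 * Real.sqrt a₂)))
    (hΛ₂ : ∀ t, Λ₂ t = K₂ (t / n + π / (2 * Real.sqrt a₁)) - K₂ (t / n - π / (2 * Real.sqrt a₁)))
    (p₁ p₂ : ℝ → ℝ) (hp₁ : Continuous p₁) (hp₂ : Continuous p₂)
    (hp₁per : ∀ t, p₁ (t + 2 * π) = p₁ t) (hp₂per : ∀ t, p₂ (t + 2 * π) = p₂ t)
    (φ₁ φ₂ : ℝ → ℝ) (hφ₁lip : LocallyLipschitz φ₁) (hφ₂lip : LocallyLipschitz φ₂)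
    (hφ₁bdd : ∃ M, ∀ x, |φ₁ x| ≤ M) (hφ₂bdd : ∃ M, ∀ x, |φ₂ x| ≤ M)
    (φ₁inf φ₂inf : ℝ)
    (hφ₁top : Tendsto φ₁ atTop (nhds φ₁inf)) (hφ₁bot : Tendsto φ₁ atBot (nhds (-φ₁inf)))
    (hφ₂top : Tendsto φ₂ atTop (nhds φ₂inf)) (hφ₂bot : Tendsto φ₂ atBot (nhds (-φ₂inf)))
    (Φ₁ Φ₂ : ℝ → ℝ)
    (hΦ₁ : ∀ θ, Φ₁ θ = -(γ₁ / 2) * ∫ t in (0 : ℝ)..(2 * π), C₁ (θ / n + t) * p₁ t)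
    (hΦ₂ : ∀ θ, Φ₂ θ = -(γ₂ / 2) * ∫ t in (0 : ℝ)..(2 * π), C₂ (θ / n + t) * p₂ t)
    (L₁ L₂ : ℝ × ℝ → ℝ)
    (hL₁ : ∀ θ : ℝ × ℝ, L₁ θ = Φ₁ θ.1 + γ₁ * n * φ₁inf * (Λ₁ (θ.1 - θ.2) - α₁))
    (hL₂ : ∀ θ : ℝ × ℝ, L₂ θ = Φ₂ θ.2 + γ₂ * n * φ₂inf * (Λ₂ (θ.2 - θ.1) - α₂))
    (ω : ℝ × ℝ) (hω₁ : L₁ ω = 0) (hω₂ : L₂ ω = 0)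
    (hD11 : fderiv ℝ L₁ ω (1, 0) < 0) (hD22 : fderiv ℝ L₂ ω (0, 1) < 0)
    (hDmix : |fderiv ℝ L₁ ω (0, 1) * fderiv ℝ L₂ ω (0, 1) +
        fderiv ℝ L₁ ω (1, 0) * fderiv ℝ L₂ ω (1, 0)| <
      2 * (fderiv ℝ L₁ ω (1, 0) * fderiv ℝ L₂ ω (0, 1))) :
    ∃ E : Set (ℝ × ℝ × ℝ × ℝ), MeasurableSet E ∧ volume E = ⊤ ∧
      ∀ x₁ x₂ v₁ v₂ : ℝ → ℝ,
        (∀ t ∈ Set.Ici (0 : ℝ),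
          HasDerivAt x₁ (v₁ t) t ∧ HasDerivAt x₂ (v₂ t) t ∧
          HasDerivAt v₁ (p₁ t - a₁ * max (x₁ t) 0 + b₁ * max (-x₁ t) 0 - φ₁ (x₂ t)) t ∧
          HasDerivAt v₂ (p₂ t - a₂ * max (x₂ t) 0 + b₂ * max (-x₂ t) 0 - φ₂ (x₁ t)) t) →
        (x₁ 0, x₂ 0, v₁ 0, v₂ 0) ∈ E →
        (Tendsto (fun t => (x₁ t) ^ 2 + (v₁ t) ^ 2) atTop atTop ∧
         Tendsto (fun t => (x₂ t) ^ 2 + (v₂ t) ^ 2) atTop atTop) := by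
  obtain ⟨S₁, o₁⟩ := exists_osc n hn a₁ b₁ ha₁ hb₁ hres₁ C₁ hC₁
  obtain ⟨S₂, o₂⟩ := exists_osc n hn a₂ b₂ ha₂ hb₂ hres₂ C₂ hC₂
  have hnp := o₁.npos
  have hap₁ := o₁.apos
  have hap₂ := o₂.apos
  have hγp₁ : 0 < γ₁ := by rw [hγ₁]; positivity
  have hγp₂ : 0 < γ₂ := by rw [hγ₂]; positivity
  have hγa₁ : γ₁ ^ 2 * a₁ = 2 * n := by
    rw [hγ₁, Real.sq_sqrt (by positivity)]; field_simp
  have hγa₂ : γ₂ ^ 2 * a₂ = 2 * n := by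
    rw [hγ₂, Real.sq_sqrt (by positivity)]; field_simp
  obtain ⟨M₁, hM₁⟩ := hφ₁bdd
  obtain ⟨M₂, hM₂⟩ := hφ₂bdd
  obtain ⟨P₁, hP₁⟩ := per_bdd p₁ hp₁ hp₁per
  obtain ⟨P₂, hP₂⟩ := per_bdd p₂ hp₂ hp₂per
  have hB₁ : 0 ≤ P₁ + M₁ := add_nonneg ((abs_nonneg _).trans (hP₁ 0)) ((abs_nonneg _).trans (hM₁ 0))
  have hB₂ : 0 ≤ P₂ + M₂ := add_nonneg ((abs_nonneg _).trans (hP₂ 0)) ((abs_nonneg _).trans (hM₂ 0))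
  have hd₁ : DifferentiableAt ℝ L₁ ω := by
    by_contra h
    rw [fderiv_zero_of_not_differentiableAt h] at hD11
    simp at hD11
  have hd₂ : DifferentiableAt ℝ L₂ ω := by
    by_contra h
    rw [fderiv_zero_of_not_differentiableAt h] at hD22
    simp at hD22
  obtain ⟨l₁, hl₁⟩ : ∃ l, l = -fderiv ℝ L₁ ω (1, 0) := ⟨_, rfl⟩
  obtain ⟨l₂, hl₂⟩ : ∃ l, l = -fderiv ℝ L₂ ω (0, 1) := ⟨_, rfl⟩
  obtain ⟨B₁, hBd₁⟩ : ∃ l, l = fderiv ℝ L₁ ω (0, 1) := ⟨_, rfl⟩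
  obtain ⟨B₂, hBd₂⟩ : ∃ l, l = fderiv ℝ L₂ ω (1, 0) := ⟨_, rfl⟩
  have e₁ : fderiv ℝ L₁ ω (1, 0) = -l₁ := by rw [hl₁, neg_neg]
  have e₂ : fderiv ℝ L₂ ω (0, 1) = -l₂ := by rw [hl₂, neg_neg]
  rw [e₁, e₂, ← hBd₁, ← hBd₂] at hDmix
  have hlp₁ : 0 < l₁ := by linarith
  have hlp₂ : 0 < l₂ := by linarith
  have hm : |B₁ / l₁ + B₂ / l₂| < 2 := by
    rw [show B₁ / l₁ + B₂ / l₂ = -(B₁ * -l₂ + -l₁ * B₂) / (l₁ * l₂) by field_simp; ring, abs_div,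
      abs_neg, abs_of_pos (by positivity : 0 < l₁ * l₂), div_lt_iff₀ (by positivity)]
    linarith
  have hder₁ : HasDerivAt (fun θ => L₁ (θ, ω.2)) (-l₁) ω.1 := by
    rw [← e₁]
    exact HasFDerivAt.comp_hasDerivAt (f := fun θ : ℝ => (θ, ω.2)) ω.1 hd₁.hasFDerivAt
      ((hasDerivAt_id' ω.1).prodMk (hasDerivAt_const ω.1 ω.2))
  have hder₂ : HasDerivAt (fun θ => L₂ (ω.1, θ)) (-l₂) ω.2 := by
    rw [← e₂]
    exact HasFDerivAt.comp_hasDerivAt (f := fun θ : ℝ => (ω.1, θ)) ω.2 hd₂.hasFDerivAt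
      ((hasDerivAt_const ω.2 ω.1).prodMk (hasDerivAt_id' ω.2))
  have hs₁ : ∀ κ > 0, CompStep n a₁ b₁ a₂ b₂ C₁ S₁ C₂ S₂ φ₁ p₁ (P₂ + M₂) (γ₁ * l₁) (γ₂ * l₂)
      (B₁ / l₁) ω.1 ω.2 κ := by
    intro κ hκ
    refine comp_step o₁ o₂ φ₁ hφ₁lip.continuous M₁ hM₁ φ₁inf hφ₁top hφ₁bot p₁ hp₁ P₁ (P₂ + M₂) hP₁ hB₂
      γ₁ l₁ (B₁ / l₁) ω.1 ω.2 (γ₂ * l₂) hγp₁ hγa₁ hlp₁ (by positivity) (fun θ θ' => L₁ (θ, θ'))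
      (fun θ θ' => ?_) hder₁ (fun κ hκ => ?_) κ hκ
    · rw [hL₁]
      exact L_avg o₁ o₂ p₁ hp₁ φ₁inf γ₁ α₁ hα₁ K₁ Λ₁ Φ₁ hK₁ hΛ₁ hΦ₁ θ θ'
    · obtain ⟨δ, hδ, h⟩ := lin_data L₁ ω hd₁ hω₁ (κ * l₁) (by positivity)
      rw [e₁, ← hBd₁] at h
      exact ⟨δ, hδ, fun z z' hz hz' => lin_scale _ _ _ _ _ _ _ hlp₁ (h z z' hz hz')⟩
  have hs₂ : ∀ κ > 0, CompStep n a₂ b₂ a₁ b₁ C₂ S₂ C₁ S₁ φ₂ p₂ (P₁ + M₁) (γ₂ * l₂) (γ₁ * l₁)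
      (B₂ / l₂) ω.2 ω.1 κ := by
    intro κ hκ
    refine comp_step o₂ o₁ φ₂ hφ₂lip.continuous M₂ hM₂ φ₂inf hφ₂top hφ₂bot p₂ hp₂ P₂ (P₁ + M₁) hP₂ hB₁
      γ₂ l₂ (B₂ / l₂) ω.2 ω.1 (γ₁ * l₁) hγp₂ hγa₂ hlp₂ (by positivity) (fun θ θ' => L₂ (θ', θ))
      (fun θ θ' => ?_) hder₂ (fun κ hκ => ?_) κ hκ
    · rw [hL₂]
      exact L_avg o₂ o₁ p₂ hp₂ φ₂inf γ₂ α₂ hα₂ K₂ Λ₂ Φ₂ hK₂ hΛ₂ hΦ₂ θ θ'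
    · obtain ⟨δ, hδ, h⟩ := lin_data L₂ ω hd₂ hω₂ (κ * l₂) (by positivity)
      rw [e₂, ← hBd₂] at h
      refine ⟨δ, hδ, fun z z' hz hz' => lin_scale _ _ _ _ _ _ _ hlp₂ ?_⟩
      have := h z' z hz' hz
      rwa [add_comm, max_comm] at this
  obtain ⟨δ, hδ, κ, hκ, R, hR, hesc⟩ := escape o₁ o₂ φ₁ φ₂ p₁ p₂ hφ₁lip.continuous hφ₂lip.continuous
    hp₁ hp₂ hp₁per hp₂per M₁ M₂ P₁ P₂ hM₁ hM₂ hP₁ hP₂ (γ₁ * l₁) (γ₂ * l₂) (B₁ / l₁) (B₂ / l₂) ω.1 ω.2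
    (by positivity) (by positivity) hm hs₁ hs₂
  obtain ⟨E, hE1, hE2, hE3⟩ := init_set o₁ o₂ (γ₁ * l₁) (γ₂ * l₂) ω.1 ω.2 δ κ R (by positivity)
    (by positivity) hδ hκ
  refine ⟨E, hE1, hE2, fun x₁ x₂ v₁ v₂ hsol hmem => ?_⟩
  obtain ⟨u₁, u₂, θ₁, θ₂, hI, hq1, hq2⟩ := hE3 _ hmem
  exact hesc x₁ x₂ v₁ v₂ u₁ u₂ θ₁ θ₂ hsol hI hq1 hq2
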